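/- Uniqueness of the optimiser, isoperimetric case (Theorem of Section 5.2, first part): Let α < 0 and let Ω ⊂ ℝ² be a nonempty convex bounded open set with smooth boundary that is not a disk (i.e. Ω is not an open Euclidean ball). Let B_{R₁} ⊂ ℝ² be an open disk with H¹(∂B_{R₁}) = H¹(∂Ω). Then the strict inequality λ₁^α(Ω^ext) < λ₁^α(B_{R₁}^ext) holds. -/

import Mathlib

open MeasureTheory Metric Set Bornology Real Filter

noncomputable section

/-- The Euclidean plane. -/
abbrev E2 := EuclideanSpace ℝ (Fin 2)

/-- The exterior of a set: complement of its closure. -/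
def extDom (Ω : Set E2) : Set E2 := (closure Ω)ᶜ

/-- The lowest Robin eigenvalue of the exterior of `Ω`, defined variationally as the
infimum of Rayleigh quotients over smooth compactly supported test functions that are
not identically zero on the exterior. -/
def robinEig (α : ℝ) (Ω : Set E2) : ℝ :=
  sInf { q : ℝ | ∃ u : E2 → ℝ, ContDiff ℝ (⊤ : ℕ∞) u ∧ HasCompactSupport u ∧
    (∃ x ∈ extDom Ω, u x ≠ 0) ∧
    q = ((∫ x in extDom Ω, ‖fderiv ℝ u x‖ ^ 2) +
          α * ∫ x in frontier Ω, (u x) ^ 2 ∂(μH[1])) /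
        (∫ x in extDom Ω, (u x) ^ 2) }

/-- A planar set has smooth boundary if its topological boundary is the image of a
smooth, periodic, regular, injective (on one period) closed curve. -/
def HasSmoothBoundary (Ω : Set E2) : Prop :=
  ∃ γ : ℝ → E2, ContDiff ℝ (⊤ : ℕ∞) γ ∧ (∀ t, γ (t + 1) = γ t) ∧
    (∀ t, deriv γ t ≠ 0) ∧ InjOn γ (Ico 0 1) ∧ range γ = frontier Ω

section ArcLength

variable {E : Type*} [NormedAddCommGroup E] [NormedSpace ℝ E]

lemma exists_norm_sub_sub_smul_le {γ γ' : ℝ → E} (hγ : ∀ s, HasDerivAt γ (γ' s) s)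
    (hc : Continuous γ') {ε : ℝ} (hε : 0 < ε) :
    ∃ δ > 0, ∀ p ∈ Icc (0 : ℝ) 1, ∀ q ∈ Icc (0 : ℝ) 1, q - p < δ →
      (∀ s ∈ Icc p q, ‖γ' s - γ' p‖ ≤ ε) ∧
      ∀ s ∈ Icc p q, ∀ r ∈ Icc p q, ‖γ s - γ r - (s - r) • γ' p‖ ≤ ε * |s - r| := by
  obtain ⟨δ, hδ, h⟩ := Metric.uniformContinuousOn_iff.1
    (isCompact_Icc.uniformContinuousOn_of_continuous hc.continuousOn) ε hε
  refine ⟨δ, hδ, fun p hp q hq hpq => ?_⟩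
  have h1 : ∀ s ∈ Icc p q, ‖γ' s - γ' p‖ ≤ ε := fun s hs => by
    rw [← dist_eq_norm]
    refine (h s ⟨hp.1.trans hs.1, hs.2.trans hq.2⟩ p hp ?_).le
    rw [Real.dist_eq, abs_of_nonneg (by linarith [hs.1])]
    linarith [hs.2]
  refine ⟨h1, fun s hs r hr => ?_⟩
  have := (convex_Icc p q).norm_image_sub_le_of_norm_hasDerivWithin_le
    (f := fun s => γ s - s • γ' p) (f' := fun s => γ' s - (1 : ℝ) • γ' p) (C := ε)
    (fun x _ => ((hγ x).sub ((hasDerivAt_id x).smul_const (γ' p))).hasDerivWithinAt)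
    (fun x hx => by simpa using h1 x hx) hr hs
  rw [Real.norm_eq_abs] at this
  convert this using 2
  rw [sub_smul]; abel

variable [MeasurableSpace E] [BorelSpace E]

lemma hausdorffMeasure_image_le_of_norm_sub_le {γ : ℝ → E} {A : Set ℝ} {e : E} {ε : ℝ}
    (hε : 0 < ε) (h : ∀ s ∈ A, ∀ r ∈ A, ‖γ s - γ r - (s - r) • e‖ ≤ ε * |s - r|) :
    μH[1] (γ '' A) ≤ ENNReal.ofReal (‖e‖ + ε) * volume A := by
  have hL : LipschitzOnWith (Real.toNNReal (‖e‖ + ε)) γ A := by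
    refine LipschitzOnWith.of_dist_le_mul fun s hs r hr => ?_
    rw [dist_eq_norm, Real.dist_eq, Real.coe_toNNReal _ (by positivity)]
    calc ‖γ s - γ r‖ = ‖(γ s - γ r - (s - r) • e) + (s - r) • e‖ := by simp
      _ ≤ ε * |s - r| + |s - r| * ‖e‖ := by
        refine (norm_add_le _ _).trans (add_le_add (h s hs r hr) ?_)
        rw [norm_smul, Real.norm_eq_abs]
      _ = _ := by ring
  have := hL.hausdorffMeasure_image_le zero_le_one
  rwa [ENNReal.rpow_one, hausdorffMeasure_real] at this

lemma ofReal_mul_volume_le_hausdorffMeasure_image {γ : ℝ → E} {A : Set ℝ} {e : E} {ε : ℝ}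
    (hε : 0 < ε) (h : ∀ s ∈ A, ∀ r ∈ A, ‖γ s - γ r - (s - r) • e‖ ≤ ε * |s - r|) :
    ENNReal.ofReal ‖e‖ * volume A ≤ μH[1] (γ '' A) + ENNReal.ofReal ε * volume A := by
  rcases le_or_gt ‖e‖ ε with he | he
  · exact le_add_left (by gcongr)
  have hpos : 0 < ‖e‖ - ε := by linarith
  have hA : ∀ s ∈ A, ∀ r ∈ A, (‖e‖ - ε) * |s - r| ≤ ‖γ s - γ r‖ := fun s hs r hr => by
    have h1 : |s - r| * ‖e‖ = ‖(γ s - γ r) - (γ s - γ r - (s - r) • e)‖ := by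
      rw [sub_sub_cancel, norm_smul, Real.norm_eq_abs]
    have h2 := norm_sub_le (γ s - γ r) (γ s - γ r - (s - r) • e)
    nlinarith [h s hs r hr]
  have hinj : InjOn γ A := fun s hs r hr hsr => by
    have := hA s hs r hr
    rw [hsr, sub_self, norm_zero] at this
    have h0 : |s - r| ≤ 0 := by
      by_contra hh
      push Not at hh
      nlinarith
    exact sub_eq_zero.1 (abs_nonpos_iff.1 h0)
  have hL : LipschitzOnWith (Real.toNNReal (‖e‖ - ε)⁻¹) (Function.invFunOn γ A) (γ '' A) := by
    refine LipschitzOnWith.of_dist_le_mul ?_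
    rintro _ ⟨s, hs, rfl⟩ _ ⟨r, hr, rfl⟩
    rw [hinj.leftInvOn_invFunOn hs, hinj.leftInvOn_invFunOn hr, dist_eq_norm (γ s), Real.dist_eq,
      Real.coe_toNNReal _ (by positivity), inv_mul_eq_div, le_div_iff₀ hpos, mul_comm]
    exact hA s hs r hr
  have h3 := hL.hausdorffMeasure_image_le zero_le_one
  rw [ENNReal.rpow_one, hausdorffMeasure_real, hinj.leftInvOn_invFunOn.image_image] at h3
  have h4 : ENNReal.ofReal (‖e‖ - ε) * volume A ≤ μH[1] (γ '' A) := by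
    calc ENNReal.ofReal (‖e‖ - ε) * volume A
        ≤ ENNReal.ofReal (‖e‖ - ε) * (ENNReal.ofReal (‖e‖ - ε)⁻¹ * μH[1] (γ '' A)) := by
          gcongr; exact h3
      _ = μH[1] (γ '' A) := by
          rw [← mul_assoc, ← ENNReal.ofReal_mul hpos.le, mul_inv_cancel₀ hpos.ne',
            ENNReal.ofReal_one, one_mul]
  calc ENNReal.ofReal ‖e‖ * volume A
      = ENNReal.ofReal (‖e‖ - ε) * volume A + ENNReal.ofReal ε * volume A := by
        rw [← add_mul, ← ENNReal.ofReal_add hpos.le hε.le, sub_add_cancel]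
    _ ≤ _ := by gcongr

lemma hausdorffMeasure_image_eq_lintegral {γ γ' : ℝ → E} (hγ : ∀ s, HasDerivAt γ (γ' s) s)
    (hc : Continuous γ') (hinj : InjOn γ (Ico 0 1)) {A : Set ℝ} (hA : MeasurableSet A)
    (hA1 : A ⊆ Ico 0 1) :
    μH[1] (γ '' A) = ∫⁻ s in A, ENNReal.ofReal ‖γ' s‖ := by
  have hγc : Continuous γ := continuous_iff_continuousAt.2 fun s => (hγ s).continuousAt
  have hvol : volume A ≤ 1 := (measure_mono hA1).trans (by simp)
  have hvm : Measurable fun s => ENNReal.ofReal ‖γ' s‖ := by fun_prop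
  have key : ∀ ε : ℝ, 0 < ε →
      μH[1] (γ '' A) ≤ (∫⁻ s in A, ENNReal.ofReal ‖γ' s‖) + ENNReal.ofReal (2 * ε) ∧
      (∫⁻ s in A, ENNReal.ofReal ‖γ' s‖) ≤ μH[1] (γ '' A) + ENNReal.ofReal (2 * ε) := by
    intro ε hε
    obtain ⟨δ, hδ, hpart⟩ := exists_norm_sub_sub_smul_le hγ hc hε
    obtain ⟨n, hn⟩ := exists_nat_one_div_lt hδ
    set m : ℝ := (n : ℝ) + 1 with hm
    have hm0 : 0 < m := by positivity
    set I : ℕ → Set ℝ := fun j => A ∩ Ico (j / m) ((j + 1) / m) with hI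
    have hIm : ∀ j, MeasurableSet (I j) := fun j => hA.inter measurableSet_Ico
    have hdisj : Pairwise (Function.onFun Disjoint I) := by
      intro i j hij
      refine Set.disjoint_left.2 fun x hx hy => ?_
      rw [hI] at hx hy
      have h1 := (div_le_iff₀ hm0).1 hx.2.1
      have h2 := (lt_div_iff₀ hm0).1 hx.2.2
      have h3 := (div_le_iff₀ hm0).1 hy.2.1
      have h4 := (lt_div_iff₀ hm0).1 hy.2.2
      have h5 : (i : ℝ) < j + 1 := by linarith
      have h6 : (j : ℝ) < i + 1 := by linarith
      norm_cast at h5 h6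
      omega
    have hcover : A = ⋃ j ∈ Finset.range (n + 1), I j := by
      ext x
      simp only [Set.mem_iUnion, Finset.mem_range, hI, exists_prop]
      constructor
      · intro hx
        have hx1 := hA1 hx
        have hxm : 0 ≤ x * m := mul_nonneg hx1.1 hm0.le
        refine ⟨⌊x * m⌋₊, ?_, hx, ?_, ?_⟩
        · rw [Nat.floor_lt hxm]
          push_cast
          nlinarith [hx1.2]
        · rw [div_le_iff₀ hm0]; exact Nat.floor_le hxm
        · rw [lt_div_iff₀ hm0]; exact Nat.lt_floor_add_one _
      · rintro ⟨j, -, hx, -⟩; exact hx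
    have hpiece : ∀ j ∈ Finset.range (n + 1),
        (∀ s ∈ I j, ‖γ' s - γ' (j / m)‖ ≤ ε) ∧
        ∀ s ∈ I j, ∀ r ∈ I j, ‖γ s - γ r - (s - r) • γ' (j / m)‖ ≤ ε * |s - r| := by
      intro j hj
      have hj' : (j : ℝ) + 1 ≤ m := by
        have := Finset.mem_range.1 hj
        rw [hm]; exact_mod_cast this
      have hsub : I j ⊆ Icc (j / m) ((j + 1) / m) := fun x hx => ⟨hx.2.1, hx.2.2.le⟩
      obtain ⟨h1, h2⟩ := hpart (j / m) ⟨by positivity, by rw [div_le_one hm0]; linarith⟩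
        ((j + 1) / m) ⟨by positivity, by rw [div_le_one hm0]; linarith⟩
        (by rw [← sub_div]; simpa using hn)
      exact ⟨fun s hs => h1 s (hsub hs), fun s hs r hr => h2 s (hsub hs) r (hsub hr)⟩
    have e1 : μH[1] (γ '' A) = ∑ j ∈ Finset.range (n + 1), μH[1] (γ '' I j) := by
      conv_lhs => rw [hcover, image_iUnion₂]
      refine measure_biUnion_finset (fun i _ j _ hij => ?_) fun j _ => ?_
      · refine Set.disjoint_left.2 ?_
        rintro _ ⟨x, hx, rfl⟩ ⟨y, hy, hxy⟩
        have := hinj (hA1 hy.1) (hA1 hx.1) hxy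
        exact Set.disjoint_left.1 (hdisj hij) hx (this ▸ hy)
      · exact (hIm j).image_of_continuousOn_injOn hγc.continuousOn
          (hinj.mono fun x hx => hA1 hx.1)
    have e2 : ∫⁻ s in A, ENNReal.ofReal ‖γ' s‖ =
        ∑ j ∈ Finset.range (n + 1), ∫⁻ s in I j, ENNReal.ofReal ‖γ' s‖ := by
      conv_lhs => rw [hcover]
      exact lintegral_biUnion_finset (fun i _ j _ hij => hdisj hij) (fun j _ => hIm j) _
    have e3 : ∑ j ∈ Finset.range (n + 1), ENNReal.ofReal (2 * ε) * volume (I j) ≤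
        ENNReal.ofReal (2 * ε) := by
      rw [← Finset.mul_sum, ← measure_biUnion_finset (fun i _ j _ hij => hdisj hij)
        (fun j _ => hIm j), ← hcover]
      exact mul_le_of_le_one_right' hvol
    have h2e : ENNReal.ofReal (2 * ε) = ENNReal.ofReal ε + ENNReal.ofReal ε := by
      rw [← ENNReal.ofReal_add hε.le hε.le, two_mul]
    rw [e1, e2]
    constructor
    · refine le_trans ?_ (add_le_add le_rfl e3)
      rw [← Finset.sum_add_distrib]
      refine Finset.sum_le_sum fun j hj => ?_
      obtain ⟨h1, h2⟩ := hpiece j hj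
      refine (hausdorffMeasure_image_le_of_norm_sub_le hε h2).trans ?_
      rw [← setLIntegral_const, ← setLIntegral_const, ← lintegral_add_left hvm]
      refine setLIntegral_mono (by fun_prop) fun s hs => ?_
      rw [← ENNReal.ofReal_add (norm_nonneg _) (by positivity)]
      refine ENNReal.ofReal_le_ofReal ?_
      have := norm_sub_norm_le (γ' (j / m)) (γ' s)
      rw [norm_sub_rev] at this
      linarith [h1 s hs]
    · refine le_trans ?_ (add_le_add le_rfl e3)
      rw [← Finset.sum_add_distrib]
      refine Finset.sum_le_sum fun j hj => ?_
      obtain ⟨h1, h2⟩ := hpiece j hj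
      calc ∫⁻ s in I j, ENNReal.ofReal ‖γ' s‖
          ≤ ∫⁻ s in I j, (ENNReal.ofReal ‖γ' (j / m)‖ + ENNReal.ofReal ε) := by
            refine setLIntegral_mono (by fun_prop) fun s hs => ?_
            rw [← ENNReal.ofReal_add (norm_nonneg _) hε.le]
            refine ENNReal.ofReal_le_ofReal ?_
            linarith [h1 s hs, norm_sub_norm_le (γ' s) (γ' (j / m))]
        _ = ENNReal.ofReal ‖γ' (j / m)‖ * volume (I j) + ENNReal.ofReal ε * volume (I j) := by
            rw [setLIntegral_const, add_mul]
        _ ≤ μH[1] (γ '' I j) + ENNReal.ofReal ε * volume (I j)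
              + ENNReal.ofReal ε * volume (I j) := by
            gcongr
            exact ofReal_mul_volume_le_hausdorffMeasure_image hε h2
        _ = _ := by rw [h2e, add_mul, add_assoc]
  have hlim : ∀ a b : ENNReal, (∀ ε : ℝ, 0 < ε → a ≤ b + ENNReal.ofReal (2 * ε)) → a ≤ b := by
    intro a b hab
    refine ENNReal.le_of_forall_pos_le_add fun ε hε _ => ?_
    have := hab (ε / 2) (by positivity)
    rwa [mul_div_cancel₀ _ two_ne_zero, ENNReal.ofReal_coe_nnreal] at this
  exact le_antisymm (hlim _ _ fun ε hε => (key ε hε).1) (hlim _ _ fun ε hε => (key ε hε).2)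

/-- The arc length formula for the Hausdorff measure on a simple closed curve. -/
lemma hausdorffMeasure_restrict_image_eq_map {γ γ' : ℝ → E}
    (hγ : ∀ s, HasDerivAt γ (γ' s) s) (hc : Continuous γ') (hinj : InjOn γ (Ico 0 1)) :
    (μH[1] : Measure E).restrict (γ '' Ico 0 1) =
      ((volume.restrict (Ico 0 1)).withDensity fun s => ENNReal.ofReal ‖γ' s‖).map γ := by
  have hγc : Continuous γ := continuous_iff_continuousAt.2 fun s => (hγ s).continuousAt
  ext B hB
  have hpre : MeasurableSet (γ ⁻¹' B) := hγc.measurable hB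
  rw [Measure.restrict_apply hB, Measure.map_apply hγc.measurable hB, withDensity_apply _ hpre,
    Measure.restrict_restrict hpre, ← hausdorffMeasure_image_eq_lintegral hγ hc hinj
      (hpre.inter measurableSet_Ico) inter_subset_right, image_preimage_inter]

end ArcLength

section HalfLine

variable {h : ℝ → ℝ}

lemma HasCompactSupport.integrable_of_forall_eq_zero (hs : HasCompactSupport h) {F : ℝ → ℝ}
    (hF : Continuous F) (h0 : ∀ t, h t = 0 → deriv h t = 0 → F t = 0) : Integrable F := by
  refine hF.integrable_of_hasCompactSupport (hs.mono' fun t ht => ?_)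
  by_contra hc
  exact ht (h0 t (image_eq_zero_of_notMem_tsupport hc)
    (Function.notMem_support.1 fun h' => hc (support_deriv_subset h')))

/-- Trace inequality on the half-line with an affine weight. -/
lemma mul_sq_le_integral_Ioi (hh : ContDiff ℝ 1 h) (hs : HasCompactSupport h) {b p q : ℝ}
    (hp : 0 ≤ p) (hq : 0 ≤ q) :
    b * p * h 0 ^ 2 ≤ ∫ t in Ioi 0, (deriv h t ^ 2 + b ^ 2 * h t ^ 2) * (p + t * q) := by
  have hc := hh.continuous
  have hd := hh.continuous_deriv le_rfl
  have hD : ∀ t, deriv (fun t => h t ^ 2) t = 2 * h t * deriv h t := fun t => by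
    have := ((hh.differentiable one_ne_zero t).hasDerivAt.pow 2).deriv
    refine Eq.trans rfl (this.trans ?_)
    simp
  have h1 : ∫ t in Ioi 0, (2 * h t * deriv h t) = - h 0 ^ 2 := by
    rw [← HasCompactSupport.integral_Ioi_deriv_eq (f := fun t => h t ^ 2) (hh.pow 2)
      (hs.mono' fun t ht => subset_tsupport _ fun h0 => ht (by simp [h0])) 0]
    exact setIntegral_congr_fun measurableSet_Ioi fun t _ => (hD t).symm
  calc b * p * h 0 ^ 2 = ∫ t in Ioi 0, (-(b * p)) * (2 * h t * deriv h t) := by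
        rw [integral_const_mul, h1]; ring
    _ ≤ _ := by
        refine setIntegral_mono_on (hs.integrable_of_forall_eq_zero (by fun_prop)
          fun t h0 _ => by simp [h0]).integrableOn (hs.integrable_of_forall_eq_zero (by fun_prop)
          fun t h0 h1 => by simp [h0, h1]).integrableOn measurableSet_Ioi fun t ht => ?_
        have ht' : 0 < t := ht
        have h2 : 0 ≤ (deriv h t ^ 2 + b ^ 2 * h t ^ 2) * (t * q) := by positivity
        nlinarith [mul_nonneg hp (sq_nonneg (deriv h t + b * h t))]

/-- Hardy type inequality on the half-line. -/
lemma mul_integral_sq_le_integral_Ioi (hh : ContDiff ℝ 1 h) (hs : HasCompactSupport h) (b : ℝ) :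
    b * ∫ t in Ioi 0, h t ^ 2 ≤ ∫ t in Ioi 0, (deriv h t ^ 2 + b ^ 2 * h t ^ 2) * t := by
  have hc := hh.continuous
  have hd := hh.continuous_deriv le_rfl
  have hD : ∀ t, deriv (fun t => t * h t ^ 2) t = h t ^ 2 + 2 * (t * h t * deriv h t) :=
    fun t => by
      have := ((hasDerivAt_id t).mul ((hh.differentiable one_ne_zero t).hasDerivAt.pow 2)).deriv
      refine Eq.trans rfl (this.trans ?_)
      simp; ring
  have i1 : IntegrableOn (fun t => h t ^ 2) (Ioi 0) :=
    (hs.integrable_of_forall_eq_zero (by fun_prop) fun t h0 _ => by simp [h0]).integrableOn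
  have i2 : IntegrableOn (fun t => 2 * (t * h t * deriv h t)) (Ioi 0) :=
    (hs.integrable_of_forall_eq_zero (by fun_prop) fun t h0 _ => by simp [h0]).integrableOn
  have h1 : ∫ t in Ioi 0, (h t ^ 2 + 2 * (t * h t * deriv h t)) = 0 := by
    have := HasCompactSupport.integral_Ioi_deriv_eq (f := fun t => t * h t ^ 2)
      (contDiff_id.mul (hh.pow 2))
      (hs.mono' fun t ht => subset_tsupport _ fun h0 => ht (by simp [h0])) 0
    simp only [zero_mul, neg_zero] at this
    refine Eq.trans ?_ this
    exact setIntegral_congr_fun measurableSet_Ioi fun t _ => (hD t).symm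
  rw [integral_add i1 i2] at h1
  calc b * ∫ t in Ioi 0, h t ^ 2 = ∫ t in Ioi 0, (-b) * (2 * (t * h t * deriv h t)) := by
        rw [integral_const_mul]; linear_combination b * h1
    _ ≤ _ := by
        refine setIntegral_mono_on (i2.const_mul _) (hs.integrable_of_forall_eq_zero (by fun_prop)
          fun t h0 h1 => by simp [h0, h1]).integrableOn measurableSet_Ioi fun t ht => ?_
        have ht' : 0 < t := ht
        nlinarith [mul_nonneg ht'.le (sq_nonneg (deriv h t + b * h t))]

lemma integral_one_add_div_le {M : ℝ} (hM : 0 ≤ M) :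
    ∫ t in Ioc 0 M, (1 + t) / (1 + t ^ 2) ≤ 2 + log (1 + M ^ 2) / 2 := by
  have hne : ∀ t : ℝ, 1 + t ^ 2 ≠ 0 := fun t => by positivity
  rw [← intervalIntegral.integral_of_le hM,
    intervalIntegral.integral_eq_sub_of_hasDerivAt
      (f := fun t => arctan t + log (1 + t ^ 2) / 2)]
  · have := arctan_lt_pi_div_two M
    have := pi_lt_four
    simp only [arctan_zero]
    norm_num
    linarith
  · intro t _
    have h1 := (hasDerivAt_arctan t).add
      (((((hasDerivAt_id t).pow 2).const_add 1).log (hne t)).div_const 2)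
    convert! h1 using 1
    simp
    field_simp
  · refine Continuous.intervalIntegrable ?_ _ _
    exact (by fun_prop : Continuous fun t : ℝ => 1 + t).div (by fun_prop) hne

/-- Points have zero capacity in the plane: logarithmic cut-off functions. -/
lemma exists_integral_Ioi_deriv_sq_mul_lt (R : ℝ) (hR : 0 < R) {b : ℝ} (hb : 0 < b) :
    ∃ h : ℝ → ℝ, ContDiff ℝ (⊤ : ℕ∞) h ∧ HasCompactSupport h ∧
      ∫ t in Ioi 0, deriv h t ^ 2 * (R + t) < b * h 0 ^ 2 := by
  set χ : ℝ → ℝ := fun x => smoothTransition (1 - x) with hχ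
  have hχs : ContDiff ℝ (⊤ : ℕ∞) χ := smoothTransition.contDiff.comp (contDiff_const.sub contDiff_id)
  have hχ0 : ∀ x, 1 ≤ x → χ x = 0 := fun x hx =>
    smoothTransition.zero_of_nonpos (by linarith)
  obtain ⟨C, hC⟩ := (isCompact_Icc (a := (0 : ℝ)) (b := 1)).exists_bound_of_continuousOn
    (hχs.continuous_deriv (by simp)).continuousOn
  have hC0 : 0 ≤ C := (norm_nonneg _).trans (hC 0 (by simp))
  set K := 4 * C ^ 2 * (R + 1) with hK
  have hK0 : 0 ≤ K := by positivity
  set N : ℝ := 1 + 3 * K / b with hN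
  have hN1 : 1 ≤ N := by rw [hN]; linarith [show 0 ≤ 3 * K / b by positivity]
  have hNpos : 0 < N := by linarith
  set M : ℝ := √(exp N - 1) with hM
  have hexp : 0 ≤ exp N - 1 := by linarith [add_one_le_exp N]
  have hM2 : 1 + M ^ 2 = exp N := by rw [hM, sq_sqrt hexp]; ring
  have hM0 : 0 ≤ M := sqrt_nonneg _
  have hpos : ∀ t : ℝ, 0 < 1 + t ^ 2 := fun t => by positivity
  set h : ℝ → ℝ := fun t => χ (log (1 + t ^ 2) / N) with hh
  have hs : ContDiff ℝ (⊤ : ℕ∞) h :=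
    hχs.comp (((contDiff_const.add (contDiff_id.pow 2)).log fun t => (hpos t).ne').div_const N)
  have hout : ∀ t, M ≤ |t| → h t = 0 := fun t ht => hχ0 _ <| by
    rw [le_div_iff₀ hNpos, one_mul, ← log_exp N, ← hM2]
    refine log_le_log (hpos M) ?_
    rw [← sq_abs t]
    gcongr
  have hcs : HasCompactSupport h := by
    refine HasCompactSupport.of_support_subset_isCompact (isCompact_Icc (a := -M) (b := M)) ?_
    intro t ht
    by_contra hc
    refine ht (hout t (le_of_not_gt fun h1 => hc ?_))
    exact ⟨(abs_lt.1 h1).1.le, (abs_lt.1 h1).2.le⟩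
  have hder : ∀ t, deriv h t = deriv χ (log (1 + t ^ 2) / N) * (2 * t / (1 + t ^ 2) / N) := by
    intro t
    have h1 := (((((hasDerivAt_id t).pow 2).const_add 1).log (hpos t).ne').div_const N)
    have h2 := ((hχs.differentiable (by simp) _).hasDerivAt.comp t h1).deriv
    refine Eq.trans rfl (h2.trans ?_)
    simp
  refine ⟨h, hs, hcs, ?_⟩
  have hh0 : h 0 = 1 := by simp [hh, hχ]
  have hzero : ∀ t ∈ Ioi M, deriv h t ^ 2 * (R + t) = 0 := by
    intro t ht
    have : h =ᶠ[nhds t] fun _ => 0 := by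
      filter_upwards [isOpen_Ioi.mem_nhds ht] with s hs
      exact hout s (le_trans (le_of_lt hs) (le_abs_self s))
    rw [this.deriv_eq]; simp
  have hsplit : ∫ t in Ioi 0, deriv h t ^ 2 * (R + t) =
      ∫ t in Ioc 0 M, deriv h t ^ 2 * (R + t) := by
    refine setIntegral_eq_of_subset_of_forall_sdiff_eq_zero measurableSet_Ioi
      (fun t ht => ht.1) fun t ht => hzero t ?_
    by_contra hc
    exact ht.2 ⟨ht.1, not_lt.1 hc⟩
  have hcont : Continuous fun t : ℝ => (1 + t) / (1 + t ^ 2) :=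
    (by fun_prop : Continuous fun t : ℝ => 1 + t).div (by fun_prop) fun t => (hpos t).ne'
  have hdc : Continuous (deriv h) := hs.continuous_deriv (by simp)
  calc ∫ t in Ioi 0, deriv h t ^ 2 * (R + t) = ∫ t in Ioc 0 M, deriv h t ^ 2 * (R + t) := hsplit
    _ ≤ ∫ t in Ioc 0 M, K / N ^ 2 * ((1 + t) / (1 + t ^ 2)) := by
        refine setIntegral_mono_on (Continuous.integrableOn_Ioc (by fun_prop))
          (Continuous.integrableOn_Ioc (by fun_prop)) measurableSet_Ioc fun t ht => ?_
        have ht0 : 0 < t := ht.1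
        have hx : log (1 + t ^ 2) / N ∈ Icc (0 : ℝ) 1 := by
          constructor
          · exact div_nonneg (log_nonneg (by nlinarith)) hNpos.le
          · rw [div_le_one hNpos, ← log_exp N, ← hM2]
            exact log_le_log (hpos t) (by nlinarith [ht.2])
        have hc1 := hC _ hx
        have hc2 : deriv χ (log (1 + t ^ 2) / N) ^ 2 ≤ C ^ 2 := by
          rw [← sq_abs]; gcongr; exact hc1
        rw [hder, mul_pow, hK]
        have e1 : (2 * t / (1 + t ^ 2) / N) ^ 2 * (R + t) ≤
            4 * (R + 1) / N ^ 2 * ((1 + t) / (1 + t ^ 2)) := by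
          have e2 : (2 * t / (1 + t ^ 2) / N) ^ 2 * (R + t) =
            4 / N ^ 2 * (t ^ 2 * (R + t) / (1 + t ^ 2) ^ 2) := by field_simp; ring
          have e3 : 4 * (R + 1) / N ^ 2 * ((1 + t) / (1 + t ^ 2)) =
            4 / N ^ 2 * ((R + 1) * (1 + t) * (1 + t ^ 2) / (1 + t ^ 2) ^ 2) := by
              field_simp
          rw [e2, e3]
          have : t ^ 2 * (R + t) ≤ (R + 1) * (1 + t) * (1 + t ^ 2) := by
            have : 0 ≤ R * t := by positivity
            have : 0 ≤ R * t * t ^ 2 := by positivity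
            nlinarith
          gcongr
        calc _ = deriv χ (log (1 + t ^ 2) / N) ^ 2 *
              ((2 * t / (1 + t ^ 2) / N) ^ 2 * (R + t)) := by ring
          _ ≤ C ^ 2 * (4 * (R + 1) / N ^ 2 * ((1 + t) / (1 + t ^ 2))) := by
            gcongr
          _ = _ := by ring
    _ ≤ K / N ^ 2 * (2 + N / 2) := by
        rw [integral_const_mul]
        gcongr
        have := integral_one_add_div_le hM0
        rwa [hM2, log_exp] at this
    _ ≤ 3 * K / N := by
        rw [div_mul_eq_mul_div, div_le_div_iff₀ (by positivity) hNpos]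
        have : 0 ≤ K * N * (N - 1) := by
          have : 0 ≤ N - 1 := by linarith
          positivity
        nlinarith
    _ < b * h 0 ^ 2 := by
        rw [hh0, div_lt_iff₀ hNpos, hN]
        field_simp
        linarith

end HalfLine

section Geometry

open scoped RealInnerProductSpace

/-- Rotation of the plane by a right angle. -/
def rot : E2 →L[ℝ] E2 :=
  LinearMap.toContinuousLinearMap
    { toFun := fun x => !₂[-x 1, x 0]
      map_add' := fun x y => by ext i; fin_cases i <;> simp; ring
      map_smul' := fun c x => by ext i; fin_cases i <;> simp }

@[simp] lemma rot_apply_zero (x : E2) : rot x 0 = -x 1 := rfl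

@[simp] lemma rot_apply_one (x : E2) : rot x 1 = x 0 := rfl

lemma inner_eq_sum_coord (x y : E2) : ⟪x, y⟫ = x 0 * y 0 + x 1 * y 1 := by
  simp [PiLp.inner_apply, Fin.sum_univ_two, mul_comm]

lemma norm_sq_eq_sum_coord (x : E2) : ‖x‖ ^ 2 = x 0 ^ 2 + x 1 ^ 2 := by
  simp [EuclideanSpace.real_norm_sq_eq, Fin.sum_univ_two]

lemma inner_rot_rot (x y : E2) : ⟪rot x, rot y⟫ = ⟪x, y⟫ := by
  simp [inner_eq_sum_coord]; ring

lemma norm_rot (x : E2) : ‖rot x‖ = ‖x‖ := by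
  rw [← sq_eq_sq₀ (norm_nonneg _) (norm_nonneg _), norm_sq_eq_sum_coord, norm_sq_eq_sum_coord]
  simp; ring

lemma rot_rot (x : E2) : rot (rot x) = -x := by
  ext i; fin_cases i <;> simp

lemma eq_inner_smul_add_inner_rot_smul {n : E2} (hn : ‖n‖ = 1) (y : E2) :
    y = ⟪n, y⟫ • n + ⟪rot n, y⟫ • rot n := by
  have h : n 0 ^ 2 + n 1 ^ 2 = 1 := by rw [← norm_sq_eq_sum_coord, hn, one_pow]
  ext i
  fin_cases i
  · simp [inner_eq_sum_coord]; linear_combination -(y 0) * h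
  · simp [inner_eq_sum_coord]; linear_combination -(y 1) * h

/-- The operator norm of a functional on the plane in an orthonormal frame. -/
lemma norm_sq_eq_frame {n : E2} (hn : ‖n‖ = 1) (L : E2 →L[ℝ] ℝ) :
    ‖L‖ ^ 2 = L n ^ 2 + L (rot n) ^ 2 := by
  obtain ⟨y, rfl⟩ := (InnerProductSpace.toDual ℝ E2).surjective L
  have h : n 0 ^ 2 + n 1 ^ 2 = 1 := by rw [← norm_sq_eq_sum_coord, hn, one_pow]
  simp only [LinearIsometryEquiv.norm_map, InnerProductSpace.toDual_apply_apply,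
    norm_sq_eq_sum_coord, inner_eq_sum_coord, rot_apply_zero, rot_apply_one]
  linear_combination (-(y 0 ^ 2) - y 1 ^ 2) * h

/-- Exterior parallel coordinates of a planar convex domain: a smooth periodic parametrisation
`γ` of the boundary with speed `v`, outward unit normal `N`, and rotation speed `w` of `N`. -/
structure Collar (Ω : Set E2) where
  γ : ℝ → E2
  N : ℝ → E2
  v : ℝ → ℝ
  w : ℝ → ℝ
  contDiff_γ : ContDiff ℝ (⊤ : ℕ∞) γ
  contDiff_N : ContDiff ℝ (⊤ : ℕ∞) N
  contDiff_v : ContDiff ℝ (⊤ : ℕ∞) v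
  contDiff_w : ContDiff ℝ (⊤ : ℕ∞) w
  periodic_γ : Function.Periodic γ 1
  periodic_N : Function.Periodic N 1
  periodic_v : Function.Periodic v 1
  periodic_w : Function.Periodic w 1
  hasDerivAt_γ : ∀ τ, HasDerivAt γ (v τ • rot (N τ)) τ
  hasDerivAt_N : ∀ τ, HasDerivAt N (w τ • rot (N τ)) τ
  norm_N : ∀ τ, ‖N τ‖ = 1
  v_pos : ∀ τ, 0 < v τ
  w_nonneg : ∀ τ, 0 ≤ w τ
  inj : ∀ σ τ, γ σ = γ τ → ∃ n : ℤ, σ = τ + n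
  range_γ : range γ = frontier Ω
  inner_le : ∀ τ, ∀ z ∈ closure Ω, ⟪N τ, z - γ τ⟫ ≤ 0

namespace Collar

variable {Ω : Set E2} (D : Collar Ω)

/-- The point at distance `t` from the boundary point with parameter `τ`. -/
def pt (τ t : ℝ) : E2 := D.γ τ + t • D.N τ

lemma γ_mem_closure (τ : ℝ) : D.γ τ ∈ closure Ω :=
  frontier_subset_closure (D.range_γ ▸ mem_range_self τ)

lemma pt_zero (τ : ℝ) : D.pt τ 0 = D.γ τ := by simp [pt]

lemma pt_add_int (τ t : ℝ) (n : ℤ) : D.pt (τ + n) t = D.pt τ t := by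
  have h1 := D.periodic_γ.int_mul n τ
  have h2 := D.periodic_N.int_mul n τ
  rw [mul_one] at h1 h2
  rw [pt, pt, h1, h2]

lemma injOn_γ : InjOn D.γ (Ico 0 1) := by
  intro σ hσ τ hτ h
  obtain ⟨n, hn⟩ := D.inj σ τ h
  have h1 : (n : ℝ) < 1 := by linarith [hσ.2, hτ.1]
  have h2 : (-1 : ℝ) < n := by linarith [hσ.1, hτ.2]
  have : n = 0 := by
    have h1' : n < 1 := by exact_mod_cast h1
    have h2' : -1 < n := by exact_mod_cast h2
    omega
  rw [hn, this]; simp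

lemma image_γ : D.γ '' Ico 0 1 = frontier Ω := by
  rw [← D.range_γ]
  refine subset_antisymm (image_subset_range _ _) ?_
  rintro _ ⟨τ, rfl⟩
  refine ⟨Int.fract τ, ⟨Int.fract_nonneg _, Int.fract_lt_one _⟩, ?_⟩
  have := D.periodic_γ.sub_int_mul_eq (x := τ) ⌊τ⌋
  rwa [mul_one, Int.self_sub_floor] at this

lemma inner_N_pt_sub (τ t : ℝ) : ⟪D.N τ, D.pt τ t - D.γ τ⟫ = t := by
  rw [pt, add_sub_cancel_left, inner_smul_right, real_inner_self_eq_norm_sq, D.norm_N]; simp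

lemma norm_γ_sub_le {σ τ s t : ℝ} (hs : 0 ≤ s) (ht : 0 ≤ t) :
    ‖D.γ σ - D.γ τ‖ ≤ ‖D.pt σ s - D.pt τ t‖ := by
  have h1 := D.inner_le σ (D.γ τ) (D.γ_mem_closure τ)
  have h2 := D.inner_le τ (D.γ σ) (D.γ_mem_closure σ)
  have h3 : ⟪D.pt σ s - D.pt τ t, D.γ σ - D.γ τ⟫ = ‖D.γ σ - D.γ τ‖ ^ 2 -
      s * ⟪D.N σ, D.γ τ - D.γ σ⟫ - t * ⟪D.N τ, D.γ σ - D.γ τ⟫ := by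
    have : D.pt σ s - D.pt τ t = (D.γ σ - D.γ τ) + s • D.N σ - t • D.N τ := by
      simp only [pt]; abel
    rw [this, inner_sub_left, inner_add_left, real_inner_self_eq_norm_sq, inner_smul_left,
      inner_smul_left, ← neg_sub (D.γ σ) (D.γ τ), inner_neg_right]
    simp
  have h4 := real_inner_le_norm (D.pt σ s - D.pt τ t) (D.γ σ - D.γ τ)
  have h5 : ‖D.γ σ - D.γ τ‖ ^ 2 ≤ ‖D.pt σ s - D.pt τ t‖ * ‖D.γ σ - D.γ τ‖ := by
    nlinarith [mul_nonpos_of_nonneg_of_nonpos hs h1, mul_nonpos_of_nonneg_of_nonpos ht h2]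
  rcases (norm_nonneg (D.γ σ - D.γ τ)).eq_or_lt with h0 | h0
  · rw [← h0]; exact norm_nonneg _
  · nlinarith

lemma norm_pt_sub_γ {τ t : ℝ} (ht : 0 ≤ t) : ‖D.pt τ t - D.γ τ‖ = t := by
  rw [pt, add_sub_cancel_left, norm_smul, D.norm_N, mul_one, Real.norm_of_nonneg ht]

lemma abs_sub_le_two_mul_norm {σ τ s t : ℝ} (hs : 0 ≤ s) (ht : 0 ≤ t) :
    |s - t| ≤ 2 * ‖D.pt σ s - D.pt τ t‖ := by
  have e : s - t = ‖D.pt σ s - D.γ σ‖ - ‖D.pt τ t - D.γ τ‖ := by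
    rw [D.norm_pt_sub_γ hs, D.norm_pt_sub_γ ht]
  rw [e]
  refine (abs_norm_sub_norm_le _ _).trans ?_
  rw [show D.pt σ s - D.γ σ - (D.pt τ t - D.γ τ) =
    (D.pt σ s - D.pt τ t) - (D.γ σ - D.γ τ) by abel]
  refine (norm_sub_le _ _).trans ?_
  linarith [D.norm_γ_sub_le (σ := σ) (τ := τ) hs ht]

lemma pt_inj {σ τ s t : ℝ} (hs : 0 ≤ s) (ht : 0 ≤ t) (h : D.pt σ s = D.pt τ t) :
    s = t ∧ D.γ σ = D.γ τ := by
  have h1 := D.norm_γ_sub_le (σ := σ) (τ := τ) hs ht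
  have h2 := D.abs_sub_le_two_mul_norm (σ := σ) (τ := τ) hs ht
  rw [h, sub_self, norm_zero] at h1 h2
  rw [mul_zero] at h2
  exact ⟨sub_eq_zero.1 (abs_nonpos_iff.1 h2), sub_eq_zero.1 (norm_le_zero_iff.1 h1)⟩

lemma pt_mem_extDom {τ t : ℝ} (ht : 0 < t) : D.pt τ t ∈ extDom Ω := by
  intro h
  have := D.inner_le τ _ h
  rw [D.inner_N_pt_sub] at this
  linarith

lemma inner_lt (ho : IsOpen Ω) (τ : ℝ) {z : E2} (hz : z ∈ Ω) : ⟪D.N τ, z - D.γ τ⟫ < 0 := by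
  obtain ⟨ε, hε, hb⟩ := Metric.isOpen_iff.1 ho z hz
  have hm : z + (ε / 2) • D.N τ ∈ Ω := hb <| by
    rw [mem_ball, dist_eq_norm, add_sub_cancel_left, norm_smul, D.norm_N, Real.norm_of_nonneg
      (by positivity)]
    linarith
  have := D.inner_le τ _ (subset_closure hm)
  rw [add_sub_right_comm, inner_add_right, inner_smul_right, real_inner_self_eq_norm_sq,
    D.norm_N] at this
  linarith

lemma exists_pt_eq (ho : IsOpen Ω) (hne : Ω.Nonempty) (hconv : Convex ℝ Ω) {x : E2}
    (hx : x ∉ Ω) : ∃ τ ∈ Ico (0 : ℝ) 1, ∃ t, 0 ≤ t ∧ D.pt τ t = x := by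
  by_cases hxc : x ∈ closure Ω
  · have hf : x ∈ frontier Ω := by rw [ho.frontier_eq]; exact ⟨hxc, hx⟩
    rw [← D.image_γ] at hf
    obtain ⟨τ, hτ, rfl⟩ := hf
    exact ⟨τ, hτ, 0, le_rfl, D.pt_zero τ⟩
  · obtain ⟨y, hy, hmin⟩ := exists_norm_eq_iInf_of_complete_convex hne.closure
      isClosed_closure.isComplete hconv.closure x
    have hin := (norm_eq_iInf_iff_real_inner_le_zero hconv.closure hy).1 hmin
    have hxy : x - y ≠ 0 := fun h => hxc (by rwa [sub_eq_zero.1 h])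
    have hyf : y ∈ frontier Ω := by
      rw [ho.frontier_eq]
      refine ⟨hy, fun hyo => ?_⟩
      obtain ⟨ε, hε, hb⟩ := Metric.isOpen_iff.1 ho y hyo
      have hn : 0 < ‖x - y‖ := norm_pos_iff.2 hxy
      have hm : y + (ε / 2 / ‖x - y‖) • (x - y) ∈ Ω := hb <| by
        rw [mem_ball, dist_eq_norm, add_sub_cancel_left, norm_smul, Real.norm_of_nonneg
          (by positivity), div_mul_cancel₀ _ hn.ne']
        linarith
      have := hin _ (subset_closure hm)
      rw [add_sub_cancel_left, inner_smul_right, real_inner_self_eq_norm_sq] at this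
      have : 0 < ε / 2 / ‖x - y‖ * ‖x - y‖ ^ 2 := by positivity
      linarith
    rw [← D.image_γ] at hyf
    obtain ⟨τ, hτ, rfl⟩ := hyf
    have hder : HasDerivAt (fun s => ⟪x - D.γ τ, D.γ s - D.γ τ⟫)
        ⟪x - D.γ τ, D.v τ • rot (D.N τ)⟫ τ := by
      have := (hasDerivAt_const τ (x - D.γ τ)).inner ℝ ((D.hasDerivAt_γ τ).sub_const (D.γ τ))
      simpa using this
    have hmax : IsLocalMax (fun s => ⟪x - D.γ τ, D.γ s - D.γ τ⟫) τ := by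
      refine Filter.Eventually.of_forall fun s => ?_
      simpa using hin _ (D.γ_mem_closure s)
    have h0 := hmax.hasDerivAt_eq_zero hder
    rw [inner_smul_right, mul_eq_zero, or_iff_right (D.v_pos τ).ne', real_inner_comm] at h0
    have hdec := eq_inner_smul_add_inner_rot_smul (D.norm_N τ) (x - D.γ τ)
    rw [h0, zero_smul, add_zero] at hdec
    refine ⟨τ, hτ, ⟪D.N τ, x - D.γ τ⟫, ?_, ?_⟩
    · obtain ⟨z, hz⟩ := hne
      have h1 := D.inner_lt ho τ hz
      have h2 := hin z (subset_closure hz)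
      rw [hdec, inner_smul_left] at h2
      by_contra hc
      push Not at hc
      have := mul_pos_of_neg_of_neg hc h1
      simp at h2
      linarith
    · rw [pt, ← hdec]; abel

end Collar

lemma exists_supporting_normal {Ω : Set E2} (ho : IsOpen Ω)
    (hconv : Convex ℝ Ω) {y : E2} (hy : y ∈ frontier Ω) :
    ∃ n : E2, (∀ z ∈ Ω, ⟪n, z - y⟫ < 0) ∧ ∀ z ∈ closure Ω, ⟪n, z - y⟫ ≤ 0 := by
  rw [ho.frontier_eq] at hy
  obtain ⟨f, hf⟩ := geometric_hahn_banach_open_point hconv ho hy.2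
  obtain ⟨n, rfl⟩ := (InnerProductSpace.toDual ℝ E2).surjective f
  have h1 : ∀ z ∈ Ω, ⟪n, z - y⟫ < 0 := fun z hz => by
    have := hf z hz
    rw [InnerProductSpace.toDual_apply_apply, InnerProductSpace.toDual_apply_apply] at this
    rw [inner_sub_right]; linarith
  refine ⟨n, h1, fun z hz => ?_⟩
  have hc : IsClosed {z : E2 | ⟪n, z - y⟫ ≤ 0} :=
    isClosed_le (by fun_prop) continuous_const
  exact hc.closure_subset_iff.2 (fun z hz => (h1 z hz).le) hz

lemma nonempty_collar_of_orientation {Ω : Set E2} (ho : IsOpen Ω) (hconv : Convex ℝ Ω)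
    {x₀ : E2} (hx₀ : x₀ ∈ Ω) {γ : ℝ → E2} (hγ : ContDiff ℝ (⊤ : ℕ∞) γ)
    (hper : Function.Periodic γ 1) (hreg : ∀ t, deriv γ t ≠ 0)
    (hinj : ∀ σ τ, γ σ = γ τ → ∃ n : ℤ, σ = τ + n) (hrange : range γ = frontier Ω)
    (hor : ∀ τ, 0 < ⟪rot (deriv γ τ), x₀ - γ τ⟫) : Nonempty (Collar Ω) := by
  have hdγ : ContDiff ℝ (⊤ : ℕ∞) (deriv γ) := by
    have := contDiff_infty_iff_deriv.1 hγ
    exact this.2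
  have hdper : Function.Periodic (deriv γ) 1 := fun t => by
    rw [← deriv_comp_add_const]
    congr 1
    exact funext hper
  set v : ℝ → ℝ := fun τ => ‖deriv γ τ‖ with hv
  have hvpos : ∀ τ, 0 < v τ := fun τ => norm_pos_iff.2 (hreg τ)
  have hvs : ContDiff ℝ (⊤ : ℕ∞) v := hdγ.norm ℝ hreg
  have hvper : Function.Periodic v 1 := fun t => by simp only [hv, hdper t]
  set N : ℝ → E2 := fun τ => -((v τ)⁻¹ • rot (deriv γ τ)) with hN
  have hNs : ContDiff ℝ (⊤ : ℕ∞) N :=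
    ((hvs.inv fun τ => (hvpos τ).ne').smul (rot.contDiff.comp hdγ)).neg
  have hNper : Function.Periodic N 1 := fun t => by simp only [hN, hvper t, hdper t]
  have hNnorm : ∀ τ, ‖N τ‖ = 1 := fun τ => by
    rw [hN, norm_neg, norm_smul, norm_rot, norm_inv, Real.norm_of_nonneg (hvpos τ).le]
    exact inv_mul_cancel₀ (hvpos τ).ne'
  have hγN : ∀ τ, deriv γ τ = v τ • rot (N τ) := fun τ => by
    simp only [hN, map_neg, map_smul, rot_rot, smul_neg, neg_neg]
    rw [smul_smul,
      mul_inv_cancel₀ (hvpos τ).ne', one_smul]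
  have hγd : ∀ τ, HasDerivAt γ (deriv γ τ) τ := fun τ =>
    (hγ.differentiable (by simp) τ).hasDerivAt
  have hmem : ∀ τ, γ τ ∈ frontier Ω := fun τ => hrange ▸ mem_range_self τ
  have hin : ∀ τ, ∀ z ∈ closure Ω, ⟪N τ, z - γ τ⟫ ≤ 0 := by
    intro τ
    obtain ⟨n, h1, h2⟩ := exists_supporting_normal ho hconv (hmem τ)
    have hder : HasDerivAt (fun s => ⟪n, γ s - γ τ⟫) ⟪n, deriv γ τ⟫ τ := by
      have := (hasDerivAt_const τ n).inner ℝ ((hγd τ).sub_const (γ τ))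
      simpa using this
    have hmax : IsLocalMax (fun s => ⟪n, γ s - γ τ⟫) τ := by
      refine Filter.Eventually.of_forall fun s => ?_
      simpa using h2 _ (frontier_subset_closure (hmem s))
    have h0 := hmax.hasDerivAt_eq_zero hder
    rw [hγN, inner_smul_right, mul_eq_zero, or_iff_right (hvpos τ).ne', real_inner_comm] at h0
    have hdec := eq_inner_smul_add_inner_rot_smul (hNnorm τ) n
    rw [h0, zero_smul, add_zero] at hdec
    have h3 := h1 _ hx₀
    have h4 : ⟪N τ, x₀ - γ τ⟫ < 0 := by
      rw [hN, inner_neg_left, inner_smul_left]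
      have := mul_pos (inv_pos.2 (hvpos τ)) (hor τ)
      simpa using this
    have h5 : 0 < ⟪N τ, n⟫ := by
      rw [hdec, inner_smul_left] at h3
      simp at h3
      by_contra hc
      push Not at hc
      linarith [mul_nonneg_of_nonpos_of_nonpos hc h4.le]
    intro z hz
    have h6 := h2 z hz
    rw [hdec, inner_smul_left] at h6
    simp at h6
    by_contra hc
    push Not at hc
    linarith [mul_pos h5 hc]
  have hNd : ∀ τ, HasDerivAt N (deriv N τ) τ := fun τ =>
    (hNs.differentiable (by simp) τ).hasDerivAt
  set w : ℝ → ℝ := fun τ => ⟪rot (N τ), deriv N τ⟫ with hw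
  have hdN : ContDiff ℝ (⊤ : ℕ∞) (deriv N) := (contDiff_infty_iff_deriv.1 hNs).2
  have hws : ContDiff ℝ (⊤ : ℕ∞) w := (rot.contDiff.comp hNs).inner ℝ hdN
  have hdNper : Function.Periodic (deriv N) 1 := fun t => by
    rw [← deriv_comp_add_const]
    congr 1
    exact funext hNper
  have hNN : ∀ τ, deriv N τ = w τ • rot (N τ) := fun τ => by
    have hd := eq_inner_smul_add_inner_rot_smul (hNnorm τ) (deriv N τ)
    have h1 : HasDerivAt (fun s => ⟪N s, N s⟫) (⟪N τ, deriv N τ⟫ + ⟪deriv N τ, N τ⟫) τ :=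
      (hNd τ).inner ℝ (hNd τ)
    have h2 : (fun s => ⟪N s, N s⟫) = fun _ => (1 : ℝ) := by
      funext s; rw [real_inner_self_eq_norm_sq, hNnorm, one_pow]
    rw [h2, real_inner_comm] at h1
    have h3 := h1.unique (hasDerivAt_const τ (1 : ℝ))
    have h4 : ⟪N τ, deriv N τ⟫ = 0 := by
      rw [real_inner_comm]; linarith
    rwa [h4, zero_smul, zero_add] at hd
  have hw0 : ∀ τ, 0 ≤ w τ := by
    intro τ
    have h1 := (hasDerivAt_iff_tendsto_slope.1 (hNd τ)).inner
      (hasDerivAt_iff_tendsto_slope.1 (hγd τ)) (𝕜 := ℝ)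
    have h2 : 0 ≤ ⟪deriv N τ, deriv γ τ⟫ := by
      refine ge_of_tendsto' h1 fun s => ?_
      rw [slope_def_module, slope_def_module, inner_smul_left, inner_smul_right]
      have a := hin τ _ (frontier_subset_closure (hmem s))
      have b := hin s _ (frontier_subset_closure (hmem τ))
      have e : ⟪N s - N τ, γ s - γ τ⟫ = -⟪N s, γ τ - γ s⟫ - ⟪N τ, γ s - γ τ⟫ := by
        rw [inner_sub_left, ← neg_sub (γ τ) (γ s), inner_neg_right]
      have : 0 ≤ ⟪N s - N τ, γ s - γ τ⟫ := by linarith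
      have h3 := mul_nonneg (mul_self_nonneg (s - τ)⁻¹) this
      simpa [mul_assoc] using h3
    rw [hNN, hγN, inner_smul_left, inner_smul_right, inner_rot_rot, real_inner_self_eq_norm_sq,
      hNnorm] at h2
    simp at h2
    exact nonneg_of_mul_nonneg_left h2 (hvpos τ)
  exact ⟨{ γ := γ, N := N, v := v, w := w, contDiff_γ := hγ, contDiff_N := hNs,
           contDiff_v := hvs, contDiff_w := hws, periodic_γ := hper, periodic_N := hNper,
           periodic_v := hvper,
           periodic_w := fun t => by simp only [hw, hNper t, hdNper t]
           hasDerivAt_γ := fun τ => hγN τ ▸ hγd τ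
           hasDerivAt_N := fun τ => hNN τ ▸ hNd τ
           norm_N := hNnorm, v_pos := hvpos, w_nonneg := hw0, inj := hinj
           range_γ := hrange, inner_le := hin }⟩

/-- A bounded convex planar domain with smooth boundary has exterior parallel coordinates. -/
lemma HasSmoothBoundary.nonempty_collar {Ω : Set E2} (hsm : HasSmoothBoundary Ω)
    (ho : IsOpen Ω) (hne : Ω.Nonempty) (hconv : Convex ℝ Ω) : Nonempty (Collar Ω) := by
  obtain ⟨γ, hγ, hper, hreg, hinj, hrange⟩ := hsm
  obtain ⟨x₀, hx₀⟩ := hne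
  have hfract : ∀ t, γ (Int.fract t) = γ t := fun t => by
    have := Function.Periodic.sub_int_mul_eq (x := t) (show Function.Periodic γ 1 from hper) ⌊t⌋
    rwa [mul_one, Int.self_sub_floor] at this
  have hinj' : ∀ σ τ, γ σ = γ τ → ∃ n : ℤ, σ = τ + n := by
    intro σ τ h
    rw [← hfract σ, ← hfract τ] at h
    have := hinj ⟨Int.fract_nonneg _, Int.fract_lt_one _⟩
      ⟨Int.fract_nonneg _, Int.fract_lt_one _⟩ h
    refine ⟨⌊σ⌋ - ⌊τ⌋, ?_⟩
    push_cast
    rw [← Int.self_sub_floor, ← Int.self_sub_floor] at this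
    linarith
  have hγd : ∀ τ, HasDerivAt γ (deriv γ τ) τ := fun τ =>
    (hγ.differentiable (by simp) τ).hasDerivAt
  have hmem : ∀ τ, γ τ ∈ frontier Ω := fun τ => hrange ▸ mem_range_self τ
  have hne0 : ∀ τ, ⟪rot (deriv γ τ), x₀ - γ τ⟫ ≠ 0 := by
    intro τ h
    obtain ⟨n, h1, h2⟩ := exists_supporting_normal ho hconv (hmem τ)
    have hder : HasDerivAt (fun s => ⟪n, γ s - γ τ⟫) ⟪n, deriv γ τ⟫ τ := by
      have := (hasDerivAt_const τ n).inner ℝ ((hγd τ).sub_const (γ τ))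
      simpa using this
    have hmax : IsLocalMax (fun s => ⟪n, γ s - γ τ⟫) τ := by
      refine Filter.Eventually.of_forall fun s => ?_
      simpa using h2 _ (frontier_subset_closure (hmem s))
    have h0 := hmax.hasDerivAt_eq_zero hder
    have h3 := h1 _ hx₀
    have hp : 0 < ‖deriv γ τ‖ ^ 2 := by
      have := norm_pos_iff.2 (hreg τ)
      positivity
    rw [norm_sq_eq_sum_coord] at hp
    simp only [inner_eq_sum_coord, rot_apply_zero, rot_apply_one] at h h0 h3
    set a := deriv γ τ 0
    set b := deriv γ τ 1
    set p := (x₀ - γ τ) 0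
    set q := (x₀ - γ τ) 1
    have : (n 0 * p + n 1 * q) * (a ^ 2 + b ^ 2) = 0 := by
      linear_combination (n 1 * a - n 0 * b) * h + (p * a + q * b) * h0
    rcases mul_eq_zero.1 this with h4 | h4
    · exact h3.ne h4
    · exact hp.ne' h4
  have hdγ : ContDiff ℝ (⊤ : ℕ∞) (deriv γ) := (contDiff_infty_iff_deriv.1 hγ).2
  have hcont : Continuous fun τ => ⟪rot (deriv γ τ), x₀ - γ τ⟫ := by
    have := hdγ.continuous
    have := hγ.continuous
    fun_prop
  have hsign : (∀ τ, 0 < ⟪rot (deriv γ τ), x₀ - γ τ⟫) ∨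
      ∀ τ, ⟪rot (deriv γ τ), x₀ - γ τ⟫ < 0 := by
    by_contra! hc
    obtain ⟨⟨a, ha⟩, b, hb⟩ := hc
    obtain ⟨t, ht⟩ := mem_range_of_exists_le_of_exists_ge hcont ⟨a, ha⟩ ⟨b, hb⟩
    exact hne0 t ht
  rcases hsign with h | h
  · exact nonempty_collar_of_orientation ho hconv hx₀ hγ hper hreg hinj' hrange h
  · have hd : ∀ τ, deriv (fun s => γ (-s)) τ = -deriv γ (-τ) := fun τ => deriv_comp_neg _ _
    refine nonempty_collar_of_orientation ho hconv hx₀ (γ := fun s => γ (-s))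
      (hγ.comp contDiff_neg) (fun t => ?_) (fun t => ?_) (fun σ τ hστ => ?_) ?_ (fun τ => ?_)
    · have := hper (-(t + 1))
      change γ (-(t + 1)) = γ (-t)
      rw [← this, show -(t + 1) + 1 = -t by ring]
    · rw [hd]; exact neg_ne_zero.2 (hreg _)
    · obtain ⟨n, hn⟩ := hinj' _ _ hστ
      exact ⟨-n, by push_cast; linarith⟩
    · rw [← hrange]
      exact neg_surjective.range_comp γ
    · rw [hd, map_neg, inner_neg_left]
      linarith [h (-τ)]

/-- The unit vector at angle `2πτ`. -/
def circ (τ : ℝ) : E2 := !₂[cos (2 * π * τ), sin (2 * π * τ)]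

lemma contDiff_circ : ContDiff ℝ (⊤ : ℕ∞) circ := by
  refine contDiff_euclidean.2 fun i => ?_
  fin_cases i
  · change ContDiff ℝ (⊤ : ℕ∞) fun τ => cos (2 * π * τ)
    fun_prop
  · change ContDiff ℝ (⊤ : ℕ∞) fun τ => sin (2 * π * τ)
    fun_prop

lemma hasDerivAt_circ (τ : ℝ) : HasDerivAt circ ((2 * π) • rot (circ τ)) τ := by
  rw [hasDerivAt_iff_hasFDerivAt, ← hasFDerivWithinAt_univ]
  refine hasFDerivWithinAt_euclidean.2 fun i => ?_
  rw [hasFDerivWithinAt_univ]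
  have hl : HasDerivAt (fun τ : ℝ => 2 * π * τ) (2 * π) τ := by
    simpa using (hasDerivAt_id τ).const_mul (2 * π)
  fin_cases i
  · change HasDerivAt (fun τ => cos (2 * π * τ)) (2 * π * -sin (2 * π * τ)) τ
    simpa [mul_comm] using hl.cos
  · change HasDerivAt (fun τ => sin (2 * π * τ)) (2 * π * cos (2 * π * τ)) τ
    simpa [mul_comm] using hl.sin

lemma periodic_circ : Function.Periodic circ 1 := fun τ => by
  simp [circ, mul_add]

lemma norm_circ (τ : ℝ) : ‖circ τ‖ = 1 := by
  have : ‖circ τ‖ ^ 2 = 1 := by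
    rw [norm_sq_eq_sum_coord]
    exact cos_sq_add_sin_sq _
  exact (sq_eq_sq₀ (norm_nonneg _) zero_le_one).1 (by rw [this, one_pow])

lemma exists_circ_eq {n : E2} (hn : ‖n‖ = 1) : ∃ τ, circ τ = n := by
  have h : n 0 ^ 2 + n 1 ^ 2 = 1 := by rw [← norm_sq_eq_sum_coord, hn, one_pow]
  set z : ℂ := ⟨n 0, n 1⟩
  have hz : ‖z‖ = 1 := by
    rw [Complex.norm_def, Complex.normSq_mk, ← sq, ← sq, h, sqrt_one]
  have hz0 : z ≠ 0 := norm_ne_zero_iff.1 (by rw [hz]; exact one_ne_zero)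
  refine ⟨Complex.arg z / (2 * π), ?_⟩
  have e : 2 * π * (Complex.arg z / (2 * π)) = Complex.arg z := by
    field_simp
  ext i
  fin_cases i
  · change cos _ = n 0
    rw [e, Complex.cos_arg hz0, hz, div_one]
  · change sin _ = n 1
    rw [e, Complex.sin_arg, hz, div_one]

/-- Polar coordinates outside a disk. -/
def ballCollar (c : E2) {R : ℝ} (hR : 0 < R) : Collar (ball c R) where
  γ τ := c + R • circ τ
  N := circ
  v _ := 2 * π * R
  w _ := 2 * π
  contDiff_γ := contDiff_const.add (contDiff_circ.const_smul R)
  contDiff_N := contDiff_circ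
  contDiff_v := contDiff_const
  contDiff_w := contDiff_const
  periodic_γ τ := by simp only [periodic_circ τ]
  periodic_N := periodic_circ
  periodic_v _ := rfl
  periodic_w _ := rfl
  hasDerivAt_γ τ := by
    have := ((hasDerivAt_circ τ).const_smul R).const_add c
    rwa [smul_smul, mul_comm] at this
  hasDerivAt_N := hasDerivAt_circ
  norm_N := norm_circ
  v_pos _ := by positivity
  w_nonneg _ := by positivity
  inj σ τ h := by
    have h1 : circ σ = circ τ := smul_right_injective E2 hR.ne' (add_left_cancel h)
    have hc : cos (2 * π * σ) = cos (2 * π * τ) := congrArg (fun x : E2 => x 0) h1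
    have hs : sin (2 * π * σ) = sin (2 * π * τ) := congrArg (fun x : E2 => x 1) h1
    have h2 : cos (2 * π * σ - 2 * π * τ) = 1 := by
      rw [cos_sub, hc, hs, ← sq, ← sq, cos_sq_add_sin_sq]
    obtain ⟨n, hn⟩ := (cos_eq_one_iff _).1 h2
    refine ⟨n, ?_⟩
    have hp : (2 * π) ≠ 0 := by positivity
    apply mul_left_cancel₀ hp
    linarith
  range_γ := by
    rw [frontier_ball c hR.ne']
    ext x
    rw [mem_sphere_iff_norm]
    constructor
    · rintro ⟨τ, rfl⟩
      rw [add_sub_cancel_left, norm_smul, norm_circ, mul_one, Real.norm_of_nonneg hR.le]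
    · intro hx
      obtain ⟨τ, hτ⟩ := exists_circ_eq (n := R⁻¹ • (x - c)) (by
        rw [norm_smul, hx, norm_inv, Real.norm_of_nonneg hR.le, inv_mul_cancel₀ hR.ne'])
      refine ⟨τ, ?_⟩
      change c + R • circ τ = x
      rw [hτ, smul_smul, mul_inv_cancel₀ hR.ne', one_smul]
      abel
  inner_le τ z hz := by
    rw [closure_ball c hR.ne', mem_closedBall_iff_norm] at hz
    rw [← sub_sub, inner_sub_right, inner_smul_right, real_inner_self_eq_norm_sq, norm_circ]
    have := real_inner_le_norm (circ τ) (z - c)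
    rw [norm_circ] at this
    linarith

end Geometry

/-- The two coordinates of a point of the plane. -/
def coordPair : E2 ≃ᵐ ℝ × ℝ :=
  (MeasurableEquiv.toLp 2 (Fin 2 → ℝ)).symm.trans MeasurableEquiv.finTwoArrow

lemma measurePreserving_coordPair : MeasurePreserving coordPair :=
  (volume_preserving_finTwoArrow ℝ).comp
    (EuclideanSpace.volume_preserving_symm_measurableEquiv_toLp (Fin 2))

namespace Collar

open scoped RealInnerProductSpace

variable {Ω : Set E2} (D : Collar Ω)

/-- The derivative of the parallel coordinates. -/
def ptFDeriv (p : E2) : E2 →L[ℝ] E2 :=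
  (EuclideanSpace.proj 0 : E2 →L[ℝ] ℝ).smulRight
      ((D.v (p 0) + p 1 * D.w (p 0)) • rot (D.N (p 0))) +
    (EuclideanSpace.proj 1 : E2 →L[ℝ] ℝ).smulRight (D.N (p 0))

lemma ptFDeriv_apply (p q : E2) : D.ptFDeriv p q =
    q 0 • ((D.v (p 0) + p 1 * D.w (p 0)) • rot (D.N (p 0))) + q 1 • D.N (p 0) := rfl

lemma hasFDerivAt_pt (p : E2) : HasFDerivAt (fun p : E2 => D.pt (p 0) (p 1)) (D.ptFDeriv p) p := by
  have h0 : HasFDerivAt (fun p : E2 => p 0) (EuclideanSpace.proj 0 : E2 →L[ℝ] ℝ) p :=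
    (EuclideanSpace.proj 0 : E2 →L[ℝ] ℝ).hasFDerivAt
  have h1 : HasFDerivAt (fun p : E2 => p 1) (EuclideanSpace.proj 1 : E2 →L[ℝ] ℝ) p :=
    (EuclideanSpace.proj 1 : E2 →L[ℝ] ℝ).hasFDerivAt
  have hγ := (D.hasDerivAt_γ (p 0)).hasFDerivAt.comp p h0
  have hN := (D.hasDerivAt_N (p 0)).hasFDerivAt.comp p h0
  refine (hγ.add (h1.smul hN)).congr_fderiv ?_
  ext q i
  simp [ptFDeriv_apply]
  ring

lemma contDiff_pt : ContDiff ℝ (⊤ : ℕ∞) fun p : E2 => D.pt (p 0) (p 1) := by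
  have h0 : ContDiff ℝ (⊤ : ℕ∞) fun p : E2 => p 0 :=
    (EuclideanSpace.proj 0 : E2 →L[ℝ] ℝ).contDiff
  have h1 : ContDiff ℝ (⊤ : ℕ∞) fun p : E2 => p 1 :=
    (EuclideanSpace.proj 1 : E2 →L[ℝ] ℝ).contDiff
  exact (D.contDiff_γ.comp h0).add (h1.smul (D.contDiff_N.comp h0))

lemma continuous_pt : Continuous fun z : ℝ × ℝ => D.pt z.1 z.2 := by
  have := D.contDiff_γ.continuous
  have := D.contDiff_N.continuous
  unfold pt
  fun_prop

lemma det_ptFDeriv (p : E2) : (D.ptFDeriv p).det = -(D.v (p 0) + p 1 * D.w (p 0)) := by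
  rw [ContinuousLinearMap.det, ← LinearMap.det_toMatrix (EuclideanSpace.basisFun (Fin 2) ℝ).toBasis,
    Matrix.det_fin_two]
  have h : D.N (p 0) 0 ^ 2 + D.N (p 0) 1 ^ 2 = 1 := by
    rw [← norm_sq_eq_sum_coord, D.norm_N, one_pow]
  simp [LinearMap.toMatrix_apply, ptFDeriv_apply]
  linear_combination (-(D.v (p 0) + p 1 * D.w (p 0))) * h

lemma weight_pos (τ : ℝ) {t : ℝ} (ht : 0 ≤ t) : 0 < D.v τ + t * D.w τ :=
  add_pos_of_pos_of_nonneg (D.v_pos τ) (mul_nonneg ht (D.w_nonneg τ))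

lemma image_pt (ho : IsOpen Ω) (hne : Ω.Nonempty) (hconv : Convex ℝ Ω) :
    (fun p : E2 => D.pt (p 0) (p 1)) '' (coordPair ⁻¹' (Ico 0 1 ×ˢ Ioi 0)) = extDom Ω := by
  apply subset_antisymm
  · rintro _ ⟨p, hp, rfl⟩
    exact D.pt_mem_extDom hp.2
  · intro x hx
    obtain ⟨τ, hτ, t, ht, rfl⟩ := D.exists_pt_eq ho hne hconv fun h => hx (subset_closure h)
    refine ⟨!₂[τ, t], ⟨hτ, ht.lt_of_ne ?_⟩, rfl⟩
    rintro h
    change (0 : ℝ) = t at h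
    rw [← h, D.pt_zero] at hx
    exact hx (D.γ_mem_closure τ)

lemma injOn_pt : InjOn (fun p : E2 => D.pt (p 0) (p 1)) (coordPair ⁻¹' (Ico 0 1 ×ˢ Ioi 0)) := by
  intro p hp q hq hpq
  obtain ⟨h1, h2⟩ := D.pt_inj (le_of_lt hp.2) (le_of_lt hq.2) hpq
  have h0 := D.injOn_γ hp.1 hq.1 h2
  ext i
  fin_cases i
  · exact h0
  · exact h1

lemma abs_det_smul_eq {p : E2} (hp : p ∈ coordPair ⁻¹' (Ico 0 1 ×ˢ Ioi 0)) (F : E2 → ℝ) :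
    |(D.ptFDeriv p).det| • F (D.pt (p 0) (p 1)) =
      F (D.pt (coordPair p).1 (coordPair p).2) *
        (D.v (coordPair p).1 + (coordPair p).2 * D.w (coordPair p).1) := by
  have hp1 : 0 < p 1 := hp.2
  rw [det_ptFDeriv, abs_neg, abs_of_pos (D.weight_pos _ hp1.le), smul_eq_mul, mul_comm]
  rfl

/-- Integration in parallel coordinates. -/
lemma integral_extDom (ho : IsOpen Ω) (hne : Ω.Nonempty) (hconv : Convex ℝ Ω) (F : E2 → ℝ) :
    ∫ x in extDom Ω, F x =
      ∫ z in Ico (0 : ℝ) 1 ×ˢ Ioi (0 : ℝ), F (D.pt z.1 z.2) * (D.v z.1 + z.2 * D.w z.1) := by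
  have hm : MeasurableSet (coordPair ⁻¹' (Ico (0 : ℝ) 1 ×ˢ Ioi (0 : ℝ))) :=
    coordPair.measurable (measurableSet_Ico.prod measurableSet_Ioi)
  rw [← D.image_pt ho hne hconv, integral_image_eq_integral_abs_det_fderiv_smul volume hm
    (fun p _ => (D.hasFDerivAt_pt p).hasFDerivWithinAt) D.injOn_pt,
    ← measurePreserving_coordPair.setIntegral_preimage_emb coordPair.measurableEmbedding]
  exact setIntegral_congr_fun hm fun p hp => D.abs_det_smul_eq hp F

lemma integrableOn_extDom_iff (ho : IsOpen Ω) (hne : Ω.Nonempty) (hconv : Convex ℝ Ω)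
    (F : E2 → ℝ) : IntegrableOn F (extDom Ω) ↔
      IntegrableOn (fun z : ℝ × ℝ => F (D.pt z.1 z.2) * (D.v z.1 + z.2 * D.w z.1))
        (Ico (0 : ℝ) 1 ×ˢ Ioi (0 : ℝ)) := by
  have hm : MeasurableSet (coordPair ⁻¹' (Ico (0 : ℝ) 1 ×ˢ Ioi (0 : ℝ))) :=
    coordPair.measurable (measurableSet_Ico.prod measurableSet_Ioi)
  rw [← D.image_pt ho hne hconv, integrableOn_image_iff_integrableOn_abs_det_fderiv_smul volume hm
    (fun p _ => (D.hasFDerivAt_pt p).hasFDerivWithinAt) D.injOn_pt,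
    ← measurePreserving_coordPair.integrableOn_comp_preimage coordPair.measurableEmbedding]
  exact integrableOn_congr_fun (fun p hp => D.abs_det_smul_eq hp F) hm

lemma norm_v_smul_rot (τ : ℝ) : ‖D.v τ • rot (D.N τ)‖ = D.v τ := by
  rw [norm_smul, norm_rot, D.norm_N, mul_one, Real.norm_of_nonneg (D.v_pos τ).le]

lemma continuous_v_smul_rot : Continuous fun τ => D.v τ • rot (D.N τ) := by
  have := D.contDiff_v.continuous
  have := D.contDiff_N.continuous
  fun_prop

/-- Integration over the boundary. -/
lemma integral_frontier {F : E2 → ℝ} (hF : Continuous F) :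
    ∫ x in frontier Ω, F x ∂μH[1] = ∫ τ in Ico (0 : ℝ) 1, F (D.γ τ) * D.v τ := by
  rw [← D.image_γ, hausdorffMeasure_restrict_image_eq_map D.hasDerivAt_γ D.continuous_v_smul_rot
    D.injOn_γ, integral_map D.contDiff_γ.continuous.aemeasurable hF.aestronglyMeasurable]
  simp_rw [D.norm_v_smul_rot]
  have hv := D.contDiff_v.continuous
  rw [integral_withDensity_eq_integral_toReal_smul (by fun_prop) (by simp)]
  refine setIntegral_congr_fun measurableSet_Ico fun τ _ => ?_
  simp only [smul_eq_mul]
  rw [ENNReal.toReal_ofReal (D.v_pos τ).le, mul_comm]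

lemma hausdorffMeasure_frontier :
    μH[1] (frontier Ω) = ENNReal.ofReal (∫ τ in Ico (0 : ℝ) 1, D.v τ) := by
  rw [← D.image_γ, hausdorffMeasure_image_eq_lintegral D.hasDerivAt_γ D.continuous_v_smul_rot
    D.injOn_γ measurableSet_Ico subset_rfl,
    ofReal_integral_eq_lintegral_ofReal]
  · simp_rw [D.norm_v_smul_rot]
  · exact (D.contDiff_v.continuous.integrableOn_Icc).mono_set Ico_subset_Icc_self
  · exact Filter.Eventually.of_forall fun τ => (D.v_pos τ).le

/-- The total rotation of the normal of a convex curve is at most one full turn. -/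
lemma integral_w_le (ho : IsOpen Ω) (hne : Ω.Nonempty) (hb : IsBounded Ω) (hconv : Convex ℝ Ω) :
    ∫ τ in Ico (0 : ℝ) 1, D.w τ ≤ 2 * π := by
  obtain ⟨x₀, hx₀⟩ := hne
  obtain ⟨d, hd⟩ := hb.closure.subset_closedBall x₀
  have hd0 : 0 ≤ d := by simpa using hd (subset_closure hx₀)
  set W := ∫ τ in Ico (0 : ℝ) 1, D.w τ with hW
  have key : ∀ s : ℝ, 0 < s → W * s ^ 2 ≤ 2 * π * (s + d) ^ 2 := by
    intro s hs
    set F : E2 → ℝ := (closedBall x₀ (s + d)).indicator fun _ => 1 with hF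
    have hfin : volume (closedBall x₀ (s + d)) ≠ ⊤ := measure_closedBall_lt_top.ne
    have hFi : Integrable F := by
      rw [hF, integrable_indicator_iff measurableSet_closedBall]
      exact integrableOn_const hfin
    have hF0 : ∀ x, 0 ≤ F x := fun x => indicator_nonneg (fun _ _ => zero_le_one) x
    have h1 : ∫ x in extDom Ω, F x ≤ π * (s + d) ^ 2 := by
      refine (setIntegral_le_integral hFi (Filter.Eventually.of_forall hF0)).trans ?_
      rw [hF, integral_indicator measurableSet_closedBall]
      simp only [integral_const, smul_eq_mul, mul_one, Measure.real]
      rw [Measure.restrict_apply_univ, EuclideanSpace.volume_closedBall_fin_two, ENNReal.toReal_mul, ENNReal.toReal_pow,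
        ENNReal.toReal_ofReal (by positivity), ENNReal.toReal_ofReal pi_pos.le, mul_comm]
    rw [D.integral_extDom ho ⟨x₀, hx₀⟩ hconv] at h1
    have hi := (D.integrableOn_extDom_iff ho ⟨x₀, hx₀⟩ hconv F).1 hFi.integrableOn
    have hsub : Ico (0 : ℝ) 1 ×ˢ Ioo (0 : ℝ) s ⊆ Ico (0 : ℝ) 1 ×ˢ Ioi (0 : ℝ) :=
      prod_mono_right Ioo_subset_Ioi_self
    have hmem : ∀ z ∈ Ico (0 : ℝ) 1 ×ˢ Ioo (0 : ℝ) s, F (D.pt z.1 z.2) = 1 := by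
      intro z hz
      refine indicator_of_mem ?_ _
      have h2 := hd (D.γ_mem_closure z.1)
      rw [mem_closedBall, dist_eq_norm] at h2 ⊢
      calc ‖D.pt z.1 z.2 - x₀‖ = ‖(D.pt z.1 z.2 - D.γ z.1) + (D.γ z.1 - x₀)‖ := by congr 1; abel
        _ ≤ z.2 + d := (norm_add_le _ _).trans
          (add_le_add (D.norm_pt_sub_γ hz.2.1.le).le h2)
        _ ≤ s + d := by linarith [hz.2.2]
    have hwc := D.contDiff_w.continuous
    have h2 : ∫ z in Ico (0 : ℝ) 1 ×ˢ Ioo (0 : ℝ) s, D.w z.1 * z.2 ≤ π * (s + d) ^ 2 := by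
      refine le_trans ?_ h1
      refine le_trans ?_ (setIntegral_mono_set hi ?_ hsub.eventuallyLE)
      · refine setIntegral_mono_on ?_ (hi.mono_set hsub)
          (measurableSet_Ico.prod measurableSet_Ioo) fun z hz => ?_
        · have hc : Continuous fun z : ℝ × ℝ => D.w z.1 * z.2 := by fun_prop
          refine (hc.continuousOn.integrableOn_compact
            (isCompact_Icc.prod isCompact_Icc)).mono_set
              (prod_mono Ico_subset_Icc_self Ioo_subset_Icc_self)
        · rw [hmem z hz]
          linarith [D.v_pos z.1]
      · rw [Filter.EventuallyLE, ae_restrict_iff' (measurableSet_Ico.prod measurableSet_Ioi)]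
        refine Filter.Eventually.of_forall fun z hz => ?_
        exact mul_nonneg (hF0 _) (D.weight_pos _ (le_of_lt hz.2)).le
    rw [Measure.volume_eq_prod, setIntegral_prod_mul (fun τ => D.w τ) (fun t => t), ← hW,
      ← integral_Ioc_eq_integral_Ioo, ← intervalIntegral.integral_of_le hs.le, integral_id] at h2
    linarith
  by_contra hc
  push Not at hc
  have hlim : Tendsto (fun s : ℝ => 2 * π * (1 + d * s⁻¹) ^ 2) atTop
      (nhds (2 * π * (1 + d * 0) ^ 2)) :=
    (((tendsto_inv_atTop_zero.const_mul d).const_add 1).pow 2).const_mul _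
  rw [mul_zero, add_zero, one_pow, mul_one] at hlim
  obtain ⟨s, hs1, hs2⟩ := ((hlim.eventually (gt_mem_nhds hc)).and (eventually_gt_atTop 0)).exists
  have h3 := key s hs2
  have h4 : 2 * π * (s + d) ^ 2 = 2 * π * (1 + d * s⁻¹) ^ 2 * s ^ 2 := by field_simp
  rw [h4] at h3
  have := le_of_mul_le_mul_right h3 (by positivity)
  linarith

end Collar

namespace Collar

open scoped RealInnerProductSpace ContDiff Manifold Topology

variable {Ω : Set E2} (D : Collar Ω)

/-- Nearby exterior points have nearby parallel coordinates, up to an integer shift. -/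
lemma eventually_exists_sub_int_mem {τ₀ t₀ : ℝ} (ht₀ : 0 ≤ t₀) {W : Set E2}
    (hW : W ∈ 𝓝 (!₂[τ₀, t₀] : E2)) :
    ∀ᶠ y in 𝓝 (D.pt τ₀ t₀), ∀ τ t, 0 ≤ t → D.pt τ t = y →
      ∃ n : ℤ, (!₂[τ - n, t] : E2) ∈ W := by
  have hc : Continuous fun z : ℝ × ℝ => (!₂[z.1, z.2] : E2) := by
    refine (PiLp.continuous_toLp 2 _).comp (continuous_pi fun i => ?_)
    fin_cases i
    · exact continuous_fst
    · exact continuous_snd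
  have hW' : (fun z : ℝ × ℝ => (!₂[z.1, z.2] : E2)) ⁻¹' W ∈ 𝓝 (τ₀, t₀) :=
    hc.continuousAt.preimage_mem_nhds hW
  obtain ⟨η, hη, hηW⟩ := Metric.mem_nhds_iff.1 hW'
  set K : Set E2 := D.γ '' (Icc (τ₀ - 1 / 2) (τ₀ + 1 / 2) \ Ioo (τ₀ - η) (τ₀ + η))
  have hK : IsClosed K :=
    ((isCompact_Icc.diff isOpen_Ioo).image D.contDiff_γ.continuous).isClosed
  have hKn : D.γ τ₀ ∉ K := by
    rintro ⟨σ, ⟨h1, h2⟩, h3⟩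
    obtain ⟨n, hn⟩ := D.inj σ τ₀ h3
    have h4 : (n : ℝ) < 1 := by linarith [h1.2]
    have h5 : (-1 : ℝ) < n := by linarith [h1.1]
    have h4' : n < 1 := by exact_mod_cast h4
    have h5' : -1 < n := by exact_mod_cast h5
    have : n = 0 := by omega
    rw [this] at hn
    simp only [Int.cast_zero, add_zero] at hn
    exact h2 ⟨by linarith, by linarith⟩
  obtain ⟨ρ, hρ, hρK⟩ := Metric.isOpen_iff.1 hK.isOpen_compl _ hKn
  filter_upwards [Metric.ball_mem_nhds (D.pt τ₀ t₀) (lt_min hρ (half_pos hη))]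
  rintro y hy τ t ht rfl
  rw [mem_ball, dist_eq_norm, lt_min_iff] at hy
  have h1 := (D.norm_γ_sub_le (σ := τ) (τ := τ₀) ht ht₀).trans_lt hy.1
  have h2 := D.abs_sub_le_two_mul_norm (σ := τ) (τ := τ₀) ht ht₀
  refine ⟨round (τ - τ₀), @hηW (τ - round (τ - τ₀), t) ?_⟩
  have h3 : D.γ (τ - round (τ - τ₀)) = D.γ τ := by
    have := D.periodic_γ.sub_int_mul_eq (x := τ) (round (τ - τ₀))
    rwa [mul_one] at this
  have h4 : D.γ (τ - round (τ - τ₀)) ∉ K := by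
    rw [h3]
    exact hρK (by rwa [mem_ball, dist_eq_norm])
  have h5 := abs_le.1 (abs_sub_round (τ - τ₀))
  have h6 : τ - round (τ - τ₀) ∈ Ioo (τ₀ - η) (τ₀ + η) := by
    by_contra hc
    exact h4 ⟨_, ⟨⟨by linarith [h5.1], by linarith [h5.2]⟩, hc⟩, rfl⟩
  rw [mem_ball, Prod.dist_eq, max_lt_iff, Real.dist_eq, Real.dist_eq, abs_lt]
  exact ⟨⟨by linarith [h6.1], by linarith [h6.2]⟩, by linarith [hy.2]⟩

/-- Functions that are products in parallel coordinates extend to test functions on the plane. -/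
lemma exists_testFunction (ho : IsOpen Ω) (hne : Ω.Nonempty) (hconv : Convex ℝ Ω)
    {a h : ℝ → ℝ} (ha : ContDiff ℝ (⊤ : ℕ∞) a) (hper : Function.Periodic a 1)
    (hh : ContDiff ℝ (⊤ : ℕ∞) h) (hs : HasCompactSupport h) :
    ∃ U : E2 → ℝ, ContDiff ℝ (⊤ : ℕ∞) U ∧ HasCompactSupport U ∧
      ∀ τ t, 0 ≤ t → U (D.pt τ t) = a τ * h t := by
  set P : E2 → E2 := fun p => D.pt (p 0) (p 1) with hP
  obtain ⟨g, hg⟩ := exists_contMDiffMap_forall_mem_convex_of_local 𝓘(ℝ, E2) (M := E2) (F := ℝ)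
    (n := (⊤ : ℕ∞)) (t := fun x => {y : ℝ | ∀ τ t, 0 ≤ t → D.pt τ t = x → y = a τ * h t})
    (fun x y hy z hz p q _ _ hpq τ t ht hx => by
      rw [hy τ t ht hx, hz τ t ht hx, ← add_smul, hpq, one_smul])
    (fun x => by
      by_cases hx : x ∈ Ω
      · refine ⟨Ω, ho.mem_nhds hx, fun _ => 0, contMDiffOn_const, ?_⟩
        rintro _ hy τ t ht rfl
        have := D.inner_lt ho τ hy
        rw [D.inner_N_pt_sub] at this
        linarith
      · obtain ⟨τ₀, -, t₀, ht₀, rfl⟩ := D.exists_pt_eq ho hne hconv hx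
        set p₀ : E2 := !₂[τ₀, t₀]
        have hdet : ∀ p : E2, 0 < D.v (p 0) + p 1 * D.w (p 0) → (D.ptFDeriv p).det ≠ 0 :=
          fun p hp => by rw [D.det_ptFDeriv]; exact neg_ne_zero.2 hp.ne'
        have hF : ∀ p : E2, ∀ hp : 0 < D.v (p 0) + p 1 * D.w (p 0), HasFDerivAt P
            (((D.ptFDeriv p).toContinuousLinearEquivOfDetNeZero (hdet p hp) : E2 ≃L[ℝ] E2) :
              E2 →L[ℝ] E2) p := fun p hp => by
          rw [ContinuousLinearMap.coe_toContinuousLinearEquivOfDetNeZero]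
          exact D.hasFDerivAt_pt p
        have hp₀ : 0 < D.v (p₀ 0) + p₀ 1 * D.w (p₀ 0) := D.weight_pos τ₀ ht₀
        have hPs : ∀ p, ContDiffAt ℝ (⊤ : ℕ∞) P p := fun p => D.contDiff_pt.contDiffAt
        set e := (hPs p₀).toOpenPartialHomeomorph P (hF p₀ hp₀) (by simp) with he
        have hes : p₀ ∈ e.source :=
          (hPs p₀).mem_toOpenPartialHomeomorph_source (hF p₀ hp₀) (by simp)
        have heP : ∀ p, e p = P p := fun p => rfl
        have hx0 : D.pt τ₀ t₀ ∈ e.target := e.map_source hes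
        have hsx : e.symm (D.pt τ₀ t₀) = p₀ := e.left_inv hes
        have hc0 : Continuous fun p : E2 => D.v (p 0) + p 1 * D.w (p 0) := by
          have := D.contDiff_v.continuous
          have := D.contDiff_w.continuous
          fun_prop
        have hV1 : ∀ᶠ y in 𝓝 (D.pt τ₀ t₀), y ∈ e.target := e.open_target.mem_nhds hx0
        have hV2 : ∀ᶠ y in 𝓝 (D.pt τ₀ t₀),
            0 < D.v (e.symm y 0) + e.symm y 1 * D.w (e.symm y 0) := by
          have h1 : ContinuousAt (fun y => D.v (e.symm y 0) + e.symm y 1 * D.w (e.symm y 0))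
              (D.pt τ₀ t₀) :=
            ContinuousAt.comp (f := e.symm) hc0.continuousAt (e.continuousAt_symm hx0)
          exact h1.eventually (lt_mem_nhds (by beta_reduce; rw [hsx]; exact hp₀))
        have hV3 := D.eventually_exists_sub_int_mem ht₀ (e.open_source.mem_nhds hes)
        refine ⟨_, hV1.and (hV2.and hV3), fun y => a (e.symm y 0) * h (e.symm y 1), ?_, ?_⟩
        · rintro y ⟨h1, h2, -⟩
          have hsy : ContDiffAt ℝ (⊤ : ℕ∞) e.symm y :=
            e.contDiffAt_symm h1 (hF _ h2) (hPs _)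
          have hy0 : ContDiffAt ℝ (⊤ : ℕ∞) (fun y => e.symm y 0) y :=
            (EuclideanSpace.proj 0 : E2 →L[ℝ] ℝ).contDiff.contDiffAt.comp y hsy
          have hy1 : ContDiffAt ℝ (⊤ : ℕ∞) (fun y => e.symm y 1) y :=
            (EuclideanSpace.proj 1 : E2 →L[ℝ] ℝ).contDiff.contDiffAt.comp y hsy
          exact ((ha.contDiffAt.comp y hy0).mul
            (hh.contDiffAt.comp y hy1)).contMDiffAt.contMDiffWithinAt
        · rintro y ⟨-, -, h3⟩ τ t ht rfl
          obtain ⟨n, hn⟩ := h3 τ t ht rfl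
          have hpt : D.pt τ t = e (!₂[τ - n, t] : E2) := by
            have := D.pt_add_int (τ - n) t n
            rw [sub_add_cancel] at this
            exact this
          have han : a (τ - n) = a τ := by
            have := hper.sub_int_mul_eq (x := τ) n
            rwa [mul_one] at this
          change a (e.symm (D.pt τ t) 0) * h (e.symm (D.pt τ t) 1) = a τ * h t
          rw [hpt, e.left_inv hn]
          change a (τ - n) * h t = _
          rw [han])
  have hgs : ContDiff ℝ (⊤ : ℕ∞) g := g.contMDiff.contDiff
  obtain ⟨T, hT⟩ := hs.isCompact.isBounded.subset_closedBall 0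
  obtain ⟨M, hM⟩ : ∃ M, ∀ τ, ‖D.γ τ‖ ≤ M := by
    have hb : IsBounded (range D.γ) := by
      rw [← (D.periodic_γ).image_Icc one_pos 0]
      exact (isCompact_Icc.image D.contDiff_γ.continuous).isBounded
    obtain ⟨M, hM⟩ := hb.exists_norm_le
    exact ⟨M, fun τ => hM _ (mem_range_self τ)⟩
  set χ : ContDiffBump (0 : E2) := ⟨|M| + |T| + 1, |M| + |T| + 2, by positivity, by linarith⟩
  refine ⟨fun x => χ x * g x, χ.contDiff.mul hgs, χ.hasCompactSupport.mul_right,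
    fun τ t ht => ?_⟩
  beta_reduce
  rw [hg (D.pt τ t) τ t ht rfl]
  by_cases h0 : h t = 0
  · rw [h0]; simp
  · have h1 := hT (subset_tsupport h h0)
    rw [mem_closedBall_zero_iff, Real.norm_of_nonneg ht] at h1
    have h2 : χ (D.pt τ t) = 1 := by
      apply χ.one_of_mem_closedBall
      rw [mem_closedBall_zero_iff]
      change _ ≤ |M| + |T| + 1
      refine (norm_add_le _ _).trans ?_
      rw [norm_smul, D.norm_N, Real.norm_of_nonneg ht]
      linarith [hM τ, le_abs_self M, le_abs_self T]
    rw [h2, one_mul]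

end Collar

lemma integrable_norm_fderiv_sq {u : E2 → ℝ} (hu : ContDiff ℝ (⊤ : ℕ∞) u)
    (hs : HasCompactSupport u) : Integrable fun x => ‖fderiv ℝ u x‖ ^ 2 := by
  have hc : Continuous fun x => ‖fderiv ℝ u x‖ ^ 2 :=
    ((hu.continuous_fderiv (by simp)).norm).pow 2
  refine hc.integrable_of_hasCompactSupport ?_
  exact (hs.fderiv (𝕜 := ℝ)).comp_left (g := fun L => ‖L‖ ^ 2) (by simp)

lemma integrable_sq {u : E2 → ℝ} (hu : ContDiff ℝ (⊤ : ℕ∞) u)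
    (hs : HasCompactSupport u) : Integrable fun x => u x ^ 2 := by
  have hc : Continuous fun x => u x ^ 2 := hu.continuous.pow 2
  refine hc.integrable_of_hasCompactSupport ?_
  exact hs.comp_left (g := fun y => y ^ 2) (by simp)

lemma volume_restrict_strip : (volume : Measure (ℝ × ℝ)).restrict (Ico 0 1 ×ˢ Ioi 0) =
    ((volume : Measure ℝ).restrict (Ico 0 1)).prod ((volume : Measure ℝ).restrict (Ioi 0)) := by
  rw [Measure.prod_restrict, Measure.volume_eq_prod]

namespace Collar

open scoped RealInnerProductSpace

variable {Ω : Set E2} (D : Collar Ω)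

lemma hasDerivAt_pt_right (τ t : ℝ) : HasDerivAt (fun t => D.pt τ t) (D.N τ) t := by
  have := ((hasDerivAt_id t).smul_const (D.N τ)).const_add (D.γ τ)
  simpa [pt] using this

lemma hasDerivAt_pt_left (τ t : ℝ) :
    HasDerivAt (fun τ => D.pt τ t) ((D.v τ + t * D.w τ) • rot (D.N τ)) τ := by
  have := (D.hasDerivAt_γ τ).add ((D.hasDerivAt_N τ).const_smul t)
  rwa [smul_smul, ← add_smul] at this

lemma contDiff_pt_right (τ : ℝ) : ContDiff ℝ (⊤ : ℕ∞) fun t => D.pt τ t :=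
  contDiff_const.add (contDiff_id.smul contDiff_const)

lemma contDiff_slice {u : E2 → ℝ} (hu : ContDiff ℝ (⊤ : ℕ∞) u) (τ : ℝ) :
    ContDiff ℝ (⊤ : ℕ∞) fun t => u (D.pt τ t) := hu.comp (D.contDiff_pt_right τ)

lemma hasDerivAt_slice {u : E2 → ℝ} (hu : ContDiff ℝ (⊤ : ℕ∞) u) (τ t : ℝ) :
    HasDerivAt (fun t => u (D.pt τ t)) (fderiv ℝ u (D.pt τ t) (D.N τ)) t :=
  ((hu.differentiable (by simp) _).hasFDerivAt).comp_hasDerivAt t (D.hasDerivAt_pt_right τ t)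

lemma hasCompactSupport_slice {u : E2 → ℝ} (hs : HasCompactSupport u) (τ : ℝ) :
    HasCompactSupport fun t => u (D.pt τ t) := by
  refine hs.comp_isClosedEmbedding (g := fun t => D.pt τ t) ?_
  have : Isometry fun t => D.pt τ t := Isometry.of_dist_eq fun s t => by
    rw [dist_eq_norm, pt, pt, add_sub_add_left_eq_sub, ← sub_smul, norm_smul, D.norm_N, mul_one,
      Real.dist_eq, Real.norm_eq_abs]
  exact this.isClosedEmbedding

/-- If all one-dimensional forms along the normals are nonnegative, then so is the Robin form. -/
lemma robin_form_nonneg_of_slice (ho : IsOpen Ω) (hne : Ω.Nonempty) (hconv : Convex ℝ Ω)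
    {u : E2 → ℝ} (hu : ContDiff ℝ (⊤ : ℕ∞) u) (hs : HasCompactSupport u) {α m : ℝ}
    (hslice : ∀ τ, 0 ≤ (∫ t in Ioi 0, (deriv (fun t => u (D.pt τ t)) t ^ 2 +
      m * u (D.pt τ t) ^ 2) * (D.v τ + t * D.w τ)) + α * (u (D.γ τ) ^ 2 * D.v τ)) :
    0 ≤ ((∫ x in extDom Ω, ‖fderiv ℝ u x‖ ^ 2) +
      α * ∫ x in frontier Ω, u x ^ 2 ∂(μH[1])) + m * ∫ x in extDom Ω, u x ^ 2 := by
  have hu1 := (integrable_norm_fderiv_sq hu hs).integrableOn (s := extDom Ω)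
  have hu2 := (integrable_sq hu hs).integrableOn (s := extDom Ω)
  rw [D.integrableOn_extDom_iff ho hne hconv] at hu1 hu2
  rw [D.integral_extDom ho hne hconv, D.integral_extDom ho hne hconv,
    D.integral_frontier (F := fun x => u x ^ 2) (hu.continuous.pow 2)]
  set S : Set (ℝ × ℝ) := Ico (0 : ℝ) 1 ×ˢ Ioi (0 : ℝ) with hS
  have hSm : MeasurableSet S := measurableSet_Ico.prod measurableSet_Ioi
  have hcv := D.contDiff_v.continuous
  have hcw := D.contDiff_w.continuous
  have hcN := D.contDiff_N.continuous
  have hcp := D.continuous_pt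
  have hcd := hu.continuous_fderiv (by simp)
  have hle : ∀ z ∈ S, fderiv ℝ u (D.pt z.1 z.2) (D.N z.1) ^ 2 * (D.v z.1 + z.2 * D.w z.1) ≤
      ‖fderiv ℝ u (D.pt z.1 z.2)‖ ^ 2 * (D.v z.1 + z.2 * D.w z.1) := by
    intro z hz
    refine mul_le_mul_of_nonneg_right ?_ (D.weight_pos _ (le_of_lt hz.2)).le
    have := (fderiv ℝ u (D.pt z.1 z.2)).le_opNorm (D.N z.1)
    rw [D.norm_N, mul_one, Real.norm_eq_abs] at this
    exact sq_le_sq' (by linarith [neg_abs_le (fderiv ℝ u (D.pt z.1 z.2) (D.N z.1))])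
      ((le_abs_self _).trans this)
  have hi : IntegrableOn (fun z : ℝ × ℝ =>
      fderiv ℝ u (D.pt z.1 z.2) (D.N z.1) ^ 2 * (D.v z.1 + z.2 * D.w z.1)) S := by
    refine Integrable.mono' hu1 ?_ ?_
    · have : Continuous fun z : ℝ × ℝ => fderiv ℝ u (D.pt z.1 z.2) (D.N z.1) :=
        (hcd.comp hcp).clm_apply (hcN.comp continuous_fst)
      exact Continuous.aestronglyMeasurable (by fun_prop)
    · filter_upwards [ae_restrict_mem hSm] with z hz
      rw [Real.norm_of_nonneg (mul_nonneg (sq_nonneg _) (D.weight_pos _ (le_of_lt hz.2)).le)]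
      exact hle z hz
  have hmono := setIntegral_mono_on hi hu1 hSm hle
  have hsum : IntegrableOn (fun z : ℝ × ℝ =>
      fderiv ℝ u (D.pt z.1 z.2) (D.N z.1) ^ 2 * (D.v z.1 + z.2 * D.w z.1) +
        m * (u (D.pt z.1 z.2) ^ 2 * (D.v z.1 + z.2 * D.w z.1))) S := hi.add (hu2.const_mul m)
  have hadd := integral_add hi (hu2.const_mul m)
  rw [integral_const_mul] at hadd
  have hsum' := hsum
  rw [IntegrableOn, hS, volume_restrict_strip] at hsum'
  have hprod := integral_prod _ hsum'
  have hib : IntegrableOn (fun τ => u (D.γ τ) ^ 2 * D.v τ) (Ico 0 1) := by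
    have hcγ := D.contDiff_γ.continuous
    have hcu := hu.continuous
    have : Continuous fun τ => u (D.γ τ) ^ 2 * D.v τ := by fun_prop
    exact (this.continuousOn.integrableOn_compact isCompact_Icc).mono_set Ico_subset_Icc_self
  have hfin := integral_add hsum'.integral_prod_left (hib.const_mul α)
  rw [integral_const_mul] at hfin
  have hnn : 0 ≤ ∫ τ in Ico (0 : ℝ) 1, ((∫ t in Ioi (0 : ℝ),
      (fderiv ℝ u (D.pt τ t) (D.N τ) ^ 2 * (D.v τ + t * D.w τ) +
        m * (u (D.pt τ t) ^ 2 * (D.v τ + t * D.w τ)))) + α * (u (D.γ τ) ^ 2 * D.v τ)) := by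
    refine integral_nonneg fun τ => ?_
    have := hslice τ
    simp only [(D.hasDerivAt_slice hu τ _).deriv] at this
    refine this.trans_eq (congrArg (· + _) ?_)
    exact integral_congr_ae (Filter.Eventually.of_forall fun t => by ring)
  rw [hS, volume_restrict_strip] at hadd
  rw [hS, volume_restrict_strip] at hmono ⊢
  linarith

end Collar

namespace Collar

variable {Ω : Set E2} (D : Collar Ω)

lemma norm_fderiv_sq_mul_le {a h : ℝ → ℝ} (ha : ContDiff ℝ (⊤ : ℕ∞) a)
    (hh : ContDiff ℝ (⊤ : ℕ∞) h) {U : E2 → ℝ} (hU : ContDiff ℝ (⊤ : ℕ∞) U)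
    (hUa : ∀ τ t, 0 ≤ t → U (D.pt τ t) = a τ * h t) (τ : ℝ) {t : ℝ} (ht : 0 < t) :
    ‖fderiv ℝ U (D.pt τ t)‖ ^ 2 * (D.v τ + t * D.w τ) ≤
      a τ ^ 2 * deriv h t ^ 2 * (D.v τ + t * D.w τ) + deriv a τ ^ 2 / D.v τ * h t ^ 2 := by
  have hW := D.weight_pos τ ht.le
  set L := fderiv ℝ U (D.pt τ t) with hL
  have hUd : HasFDerivAt U L (D.pt τ t) := (hU.differentiable (by simp) _).hasFDerivAt
  have hN : L (D.N τ) = a τ * deriv h t := by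
    have h1 : HasDerivAt (fun t => a τ * h t) (a τ * deriv h t) t :=
      ((hh.differentiable (by simp) t).hasDerivAt).const_mul _
    have h2 : (fun t => U (D.pt τ t)) =ᶠ[nhds t] fun t => a τ * h t := by
      filter_upwards [lt_mem_nhds ht] with s hs using hUa τ s hs.le
    exact (D.hasDerivAt_slice hU τ t).unique (h1.congr_of_eventuallyEq h2)
  have hT : (D.v τ + t * D.w τ) * L (rot (D.N τ)) = deriv a τ * h t := by
    have h1 : HasDerivAt (fun τ => U (D.pt τ t)) (L ((D.v τ + t * D.w τ) • rot (D.N τ))) τ :=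
      hUd.comp_hasDerivAt τ (D.hasDerivAt_pt_left τ t)
    have h2 : HasDerivAt (fun τ => a τ * h t) (deriv a τ * h t) τ :=
      ((ha.differentiable (by simp) τ).hasDerivAt).mul_const _
    rw [show (fun τ => U (D.pt τ t)) = fun τ => a τ * h t from funext fun s => hUa s t ht.le] at h1
    rw [← h1.unique h2, map_smul, smul_eq_mul]
  rw [norm_sq_eq_frame (D.norm_N τ), hN, add_mul, mul_pow]
  refine add_le_add le_rfl ?_
  have e : L (rot (D.N τ)) ^ 2 * (D.v τ + t * D.w τ) =
      (deriv a τ * h t) ^ 2 / (D.v τ + t * D.w τ) := by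
    rw [← hT, eq_div_iff hW.ne']; ring
  rw [e, div_mul_eq_mul_div, mul_pow]
  refine div_le_div_of_nonneg_left (by positivity) (D.v_pos τ) ?_
  linarith [mul_nonneg ht.le (D.w_nonneg τ)]

lemma integrableOn_Ico {f : ℝ → ℝ} (hf : Continuous f) : IntegrableOn f (Ico 0 1) :=
  (hf.continuousOn.integrableOn_compact isCompact_Icc).mono_set Ico_subset_Icc_self

lemma continuous_deriv_of_contDiff {h : ℝ → ℝ} (hh : ContDiff ℝ (⊤ : ℕ∞) h) :
    Continuous (deriv h) := hh.continuous_deriv (by simp)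

/-- The mass of a product test function. -/
lemma integral_product_sq (ho : IsOpen Ω) (hne : Ω.Nonempty) (hconv : Convex ℝ Ω)
    {a h : ℝ → ℝ} (ha : ContDiff ℝ (⊤ : ℕ∞) a) (hh : ContDiff ℝ (⊤ : ℕ∞) h)
    (hs : HasCompactSupport h) {U : E2 → ℝ}
    (hUa : ∀ τ t, 0 ≤ t → U (D.pt τ t) = a τ * h t) :
    ∫ x in extDom Ω, U x ^ 2 = (∫ τ in Ico 0 1, a τ ^ 2 * D.v τ) * (∫ t in Ioi 0, h t ^ 2) +
      (∫ τ in Ico 0 1, a τ ^ 2 * D.w τ) * (∫ t in Ioi 0, h t ^ 2 * t) := by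
  have hcv := D.contDiff_v.continuous
  have hcw := D.contDiff_w.continuous
  have hca := ha.continuous
  have hch := hh.continuous
  have i1 : IntegrableOn (fun τ => a τ ^ 2 * D.v τ) (Ico 0 1) := integrableOn_Ico (by fun_prop)
  have i2 : IntegrableOn (fun τ => a τ ^ 2 * D.w τ) (Ico 0 1) := integrableOn_Ico (by fun_prop)
  have j1 : Integrable (fun t => h t ^ 2) :=
    hs.integrable_of_forall_eq_zero (by fun_prop) fun t h0 _ => by simp [h0]
  have j2 : Integrable (fun t => h t ^ 2 * t) :=
    hs.integrable_of_forall_eq_zero (by fun_prop) fun t h0 _ => by simp [h0]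
  have k := integral_add (i1.mul_prod (j1.integrableOn (s := Ioi 0)))
    (i2.mul_prod (j2.integrableOn (s := Ioi 0)))
  have p (f g : ℝ → ℝ) := integral_prod_mul (μ := volume.restrict (Ico (0 : ℝ) 1))
    (ν := volume.restrict (Ioi (0 : ℝ))) f g
  rw [p (fun τ => a τ ^ 2 * D.v τ) (fun t => h t ^ 2),
    p (fun τ => a τ ^ 2 * D.w τ) (fun t => h t ^ 2 * t)] at k
  rw [D.integral_extDom ho hne hconv, ← k, ← volume_restrict_strip]
  refine setIntegral_congr_fun (measurableSet_Ico.prod measurableSet_Ioi) fun z hz => ?_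
  have hz2 : 0 < z.2 := hz.2
  simp only [hUa z.1 z.2 hz2.le]
  ring

/-- The Robin form of a product test function. -/
lemma robin_form_product_le (ho : IsOpen Ω) (hne : Ω.Nonempty) (hconv : Convex ℝ Ω)
    {a h : ℝ → ℝ} (ha : ContDiff ℝ (⊤ : ℕ∞) a) (hh : ContDiff ℝ (⊤ : ℕ∞) h)
    (hs : HasCompactSupport h) {U : E2 → ℝ} (hU : ContDiff ℝ (⊤ : ℕ∞) U)
    (hUs : HasCompactSupport U)
    (hUa : ∀ τ t, 0 ≤ t → U (D.pt τ t) = a τ * h t) (α m : ℝ) :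
    ((∫ x in extDom Ω, ‖fderiv ℝ U x‖ ^ 2) + α * ∫ x in frontier Ω, U x ^ 2 ∂(μH[1])) +
        m * ∫ x in extDom Ω, U x ^ 2 ≤
      (∫ τ in Ico 0 1, a τ ^ 2 * D.v τ) *
          ((∫ t in Ioi 0, (deriv h t ^ 2 + m * h t ^ 2)) + α * h 0 ^ 2) +
        (∫ τ in Ico 0 1, a τ ^ 2 * D.w τ) * (∫ t in Ioi 0, (deriv h t ^ 2 + m * h t ^ 2) * t) +
        (∫ τ in Ico 0 1, deriv a τ ^ 2 / D.v τ) * ∫ t in Ioi 0, h t ^ 2 := by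
  have hcv := D.contDiff_v.continuous
  have hcw := D.contDiff_w.continuous
  have hca := ha.continuous
  have hch := hh.continuous
  have hca' := continuous_deriv_of_contDiff ha
  have hch' := continuous_deriv_of_contDiff hh
  have i1 : IntegrableOn (fun τ => a τ ^ 2 * D.v τ) (Ico 0 1) := integrableOn_Ico (by fun_prop)
  have i2 : IntegrableOn (fun τ => a τ ^ 2 * D.w τ) (Ico 0 1) := integrableOn_Ico (by fun_prop)
  have i3 : IntegrableOn (fun τ => deriv a τ ^ 2 / D.v τ) (Ico 0 1) :=
    integrableOn_Ico ((hca'.pow 2).div hcv fun τ => (D.v_pos τ).ne')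
  have j1 : Integrable (fun t => deriv h t ^ 2 + m * h t ^ 2) :=
    hs.integrable_of_forall_eq_zero (by fun_prop) fun t h0 h1 => by simp [h0, h1]
  have j2 : Integrable (fun t => (deriv h t ^ 2 + m * h t ^ 2) * t) :=
    hs.integrable_of_forall_eq_zero (by fun_prop) fun t h0 h1 => by simp [h0, h1]
  have j3 : Integrable (fun t => h t ^ 2) :=
    hs.integrable_of_forall_eq_zero (by fun_prop) fun t h0 _ => by simp [h0]
  have m1 := i1.mul_prod (j1.integrableOn (s := Ioi 0))
  have m2 := i2.mul_prod (j2.integrableOn (s := Ioi 0))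
  have m3 := i3.mul_prod (j3.integrableOn (s := Ioi 0))
  have k := integral_add (m1.add m2) m3
  have k' := integral_add m1 m2
  have p (f g : ℝ → ℝ) := integral_prod_mul (μ := volume.restrict (Ico (0 : ℝ) 1))
    (ν := volume.restrict (Ioi (0 : ℝ))) f g
  rw [p (fun τ => a τ ^ 2 * D.v τ) (fun t => deriv h t ^ 2 + m * h t ^ 2),
    p (fun τ => a τ ^ 2 * D.w τ) (fun t => (deriv h t ^ 2 + m * h t ^ 2) * t)] at k'
  simp only [Pi.add_apply] at k
  rw [k', p (fun τ => deriv a τ ^ 2 / D.v τ) (fun t => h t ^ 2), ← volume_restrict_strip] at k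
  have hu1 := (integrable_norm_fderiv_sq hU hUs).integrableOn (s := extDom Ω)
  have hu2 := (integrable_sq hU hUs).integrableOn (s := extDom Ω)
  have hb : ∫ x in frontier Ω, U x ^ 2 ∂(μH[1]) = (∫ τ in Ico 0 1, a τ ^ 2 * D.v τ) * h 0 ^ 2 := by
    rw [D.integral_frontier (F := fun x => U x ^ 2) (hU.continuous.pow 2), ← integral_mul_const]
    congr 1
    funext τ
    rw [← D.pt_zero, hUa τ 0 le_rfl]
    ring
  have hadd := integral_add hu1 (hu2.const_mul m)
  rw [integral_const_mul] at hadd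
  have hu : IntegrableOn (fun x => ‖fderiv ℝ U x‖ ^ 2 + m * U x ^ 2) (extDom Ω) :=
    hu1.add (hu2.const_mul m)
  rw [D.integrableOn_extDom_iff ho hne hconv] at hu
  rw [D.integral_extDom ho hne hconv] at hadd
  have hR := (m1.add m2).add m3
  rw [← volume_restrict_strip] at hR
  have hle := setIntegral_mono_on hu hR (measurableSet_Ico.prod measurableSet_Ioi) (fun z hz => by
    have hz2 : 0 < z.2 := hz.2
    have := D.norm_fderiv_sq_mul_le ha hh hU hUa z.1 hz2
    simp only [Pi.add_apply, hUa z.1 z.2 hz2.le]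
    linear_combination this)
  simp only [Pi.add_apply] at hle
  rw [k, hadd] at hle
  rw [hb]
  linarith

end Collar

namespace Collar

variable {Ω : Set E2} (D : Collar Ω)

/-- A convex domain whose boundary has constant curvature is a disk. -/
lemma eq_ball_of_w_eq (ho : IsOpen Ω) (hne : Ω.Nonempty) (hb : IsBounded Ω) (hconv : Convex ℝ Ω)
    {R : ℝ} (hR : 0 < R) (hw : ∀ τ, R * D.w τ = D.v τ) : ∃ c, Ω = ball c R := by
  have hd : ∀ τ, HasDerivAt (fun τ => D.γ τ - R • D.N τ) 0 τ := fun τ => by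
    have := (D.hasDerivAt_γ τ).sub ((D.hasDerivAt_N τ).const_smul R)
    rwa [smul_smul, hw, sub_self] at this
  set c : E2 := D.γ 0 - R • D.N 0 with hc
  have hγ : ∀ τ, D.γ τ = c + R • D.N τ := fun τ => by
    have h1 : D.γ τ - R • D.N τ = c :=
      is_const_of_deriv_eq_zero (fun τ => (hd τ).differentiableAt) (fun τ => (hd τ).deriv) τ 0
    rw [← h1]; abel
  have hnorm : ∀ τ t, 0 ≤ t → ‖D.pt τ t - c‖ = R + t := fun τ t ht => by
    rw [pt, hγ, add_assoc, add_sub_cancel_left, ← add_smul, norm_smul, D.norm_N, mul_one,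
      Real.norm_of_nonneg (by positivity)]
  refine ⟨c, subset_antisymm ?_ fun x hx => ?_⟩
  · rw [← interior_closedBall c hR.ne']
    refine interior_maximal (fun z hz => ?_) ho
    rw [mem_closedBall_iff_norm]
    obtain ⟨y, hy, hmax⟩ := hb.isCompact_closure.exists_isMaxOn hne.closure
      (f := fun z => ‖z - c‖) (by fun_prop)
    refine (hmax (subset_closure hz)).trans ?_
    change ‖y - c‖ ≤ R
    rcases eq_or_ne y c with rfl | hyc
    · simpa using hR.le
    by_cases hyo : y ∈ Ω
    · exfalso
      obtain ⟨ε, hε, hball⟩ := Metric.isOpen_iff.1 ho y hyo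
      have hn : 0 < ‖y - c‖ := norm_pos_iff.2 (sub_ne_zero.2 hyc)
      have hm : y + (ε / 2 / ‖y - c‖) • (y - c) ∈ Ω := hball <| by
        rw [mem_ball, dist_eq_norm, add_sub_cancel_left, norm_smul, Real.norm_of_nonneg
          (by positivity), div_mul_cancel₀ _ hn.ne']
        linarith
      have h1 := hmax (subset_closure hm)
      change ‖y + (ε / 2 / ‖y - c‖) • (y - c) - c‖ ≤ ‖y - c‖ at h1
      rw [show y + (ε / 2 / ‖y - c‖) • (y - c) - c = (1 + ε / 2 / ‖y - c‖) • (y - c) by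
        rw [add_smul, one_smul]; abel, norm_smul, Real.norm_of_nonneg (by positivity)] at h1
      have : 0 < ε / 2 / ‖y - c‖ * ‖y - c‖ := by positivity
      linarith
    · have hyf : y ∈ frontier Ω := by rw [ho.frontier_eq]; exact ⟨hy, hyo⟩
      rw [← D.range_γ] at hyf
      obtain ⟨τ, rfl⟩ := hyf
      have := hnorm τ 0 le_rfl
      rw [D.pt_zero, add_zero] at this
      exact this.le
  · by_contra hxo
    obtain ⟨τ, -, t, ht, rfl⟩ := D.exists_pt_eq ho hne hconv hxo
    rw [mem_ball_iff_norm, hnorm τ t ht] at hx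
    linarith

end Collar

/-- The set of Rayleigh quotients of the exterior Robin problem. -/
def robinSet (α : ℝ) (Ω : Set E2) : Set ℝ :=
  { q : ℝ | ∃ u : E2 → ℝ, ContDiff ℝ (⊤ : ℕ∞) u ∧ HasCompactSupport u ∧
    (∃ x ∈ extDom Ω, u x ≠ 0) ∧
    q = ((∫ x in extDom Ω, ‖fderiv ℝ u x‖ ^ 2) +
          α * ∫ x in frontier Ω, (u x) ^ 2 ∂(μH[1])) /
        (∫ x in extDom Ω, (u x) ^ 2) }

lemma integral_sq_pos_of_ne_zero {Ω : Set E2} {u : E2 → ℝ} (hu : ContDiff ℝ (⊤ : ℕ∞) u)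
    (hs : HasCompactSupport u) (hx : ∃ x ∈ extDom Ω, u x ≠ 0) : 0 < ∫ x in extDom Ω, u x ^ 2 := by
  rw [setIntegral_pos_iff_support_of_nonneg_ae (Filter.Eventually.of_forall fun x => sq_nonneg _)
    (integrable_sq hu hs).integrableOn]
  have ho : IsOpen (Function.support (fun x => u x ^ 2) ∩ extDom Ω) :=
    ((hu.continuous.pow 2).isOpen_support).inter isClosed_closure.isOpen_compl
  refine ho.measure_pos volume ?_
  obtain ⟨x, hx, h⟩ := hx
  exact ⟨x, pow_ne_zero 2 h, hx⟩

namespace Collar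

variable {Ω : Set E2} (D : Collar Ω)

/-- On a domain that is not a disk there is a tangential profile that gains energy. -/
lemma exists_profile (ho : IsOpen Ω) (hne : Ω.Nonempty) (hb : IsBounded Ω) (hconv : Convex ℝ Ω)
    (hnd : ¬ ∃ (x : E2) (r : ℝ), Ω = ball x r) {R : ℝ} (hR : 0 < R)
    (hV : ∫ τ in Ico 0 1, D.v τ = 2 * π * R) (c : ℝ) (hc : 0 ≤ c) :
    ∃ a : ℝ → ℝ, ContDiff ℝ (⊤ : ℕ∞) a ∧ Function.Periodic a 1 ∧ (∀ τ, 0 < a τ) ∧ ∃ η > 0,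
      (∫ τ in Ico 0 1, a τ ^ 2 * D.w τ) - (∫ τ in Ico 0 1, a τ ^ 2 * D.v τ) / R +
        c * ∫ τ in Ico 0 1, deriv a τ ^ 2 / D.v τ ≤ -η := by
  set ρ : ℝ → ℝ := fun τ => D.w τ / D.v τ - 1 / R with hρ
  have hv0 : ∀ τ, D.v τ ≠ 0 := fun τ => (D.v_pos τ).ne'
  have hρs : ContDiff ℝ (⊤ : ℕ∞) ρ := (D.contDiff_w.div D.contDiff_v hv0).sub contDiff_const
  have hρp : Function.Periodic ρ 1 := fun τ => by simp only [hρ, D.periodic_w τ, D.periodic_v τ]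
  have hcv := D.contDiff_v.continuous
  have hcw := D.contDiff_w.continuous
  have hcρ := hρs.continuous
  have hcρ' := continuous_deriv_of_contDiff hρs
  have hρv : ∀ τ, D.w τ = (ρ τ + 1 / R) * D.v τ := fun τ => by
    simp only [hρ]; field_simp [hv0 τ]; ring
  obtain ⟨τ₀, hτ₀, hne0⟩ : ∃ τ ∈ Ico (0 : ℝ) 1, ρ τ ≠ 0 := by
    by_contra! hall
    refine hnd ?_
    obtain ⟨c, hc⟩ := D.eq_ball_of_w_eq ho hne hb hconv hR fun τ => by
      obtain ⟨σ, hσ, hστ⟩ := hρp.exists_mem_Ico₀ one_pos τ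
      rw [hρv, hστ, hall σ hσ]
      field_simp
      ring
    exact ⟨c, R, hc⟩
  set d := ∫ τ in Ico 0 1, ρ τ ^ 2 * D.v τ with hd
  have hdpos : 0 < d := by
    rw [hd, integral_Ico_eq_integral_Ioo, ← integral_Ioc_eq_integral_Ioo,
      ← intervalIntegral.integral_of_le zero_le_one]
    refine intervalIntegral.integral_pos one_pos (by fun_prop) (fun τ _ => ?_)
      ⟨τ₀, Ico_subset_Icc_self hτ₀, ?_⟩
    · have := D.v_pos τ
      positivity
    · have := D.v_pos τ₀
      positivity
  set c₁ := ∫ τ in Ico 0 1, deriv ρ τ ^ 2 / D.v τ with hc₁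
  set c₂ := ∫ τ in Ico 0 1, ρ τ ^ 3 * D.v τ with hc₂
  have hc₁0 : 0 ≤ c₁ := integral_nonneg fun τ => div_nonneg (sq_nonneg _) (D.v_pos τ).le
  obtain ⟨C, hC⟩ : ∃ C, ∀ τ, ‖ρ τ‖ ≤ C := by
    have hb : IsBounded (range ρ) := by
      rw [← hρp.image_Icc one_pos 0]
      exact (isCompact_Icc.image hcρ).isBounded
    obtain ⟨M, hM⟩ := hb.exists_norm_le
    exact ⟨M, fun τ => hM _ (mem_range_self τ)⟩
  have hC0 : 0 ≤ C := (norm_nonneg _).trans (hC 0)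
  set ε := min (1 / (C + 1)) (d / (|c₂| + c * c₁ + 1)) with hε
  have hden : 0 < |c₂| + c * c₁ + 1 := by positivity
  have hεpos : 0 < ε := lt_min (by positivity) (by positivity)
  have hε1 : ε * (C + 1) ≤ 1 := by
    have := min_le_left (1 / (C + 1)) (d / (|c₂| + c * c₁ + 1))
    rwa [← hε, le_div_iff₀ (by positivity)] at this
  have hε2 : ε * (|c₂| + c * c₁ + 1) ≤ d := by
    have := min_le_right (1 / (C + 1)) (d / (|c₂| + c * c₁ + 1))
    rwa [← hε, le_div_iff₀ hden] at this
  have i0 : IntegrableOn (fun τ => ρ τ * D.v τ) (Ico 0 1) := integrableOn_Ico (by fun_prop)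
  have i1 : IntegrableOn (fun τ => ρ τ ^ 2 * D.v τ) (Ico 0 1) := integrableOn_Ico (by fun_prop)
  have i2 : IntegrableOn (fun τ => ρ τ ^ 3 * D.v τ) (Ico 0 1) := integrableOn_Ico (by fun_prop)
  have iv : IntegrableOn D.v (Ico 0 1) := integrableOn_Ico hcv
  have h0 : ∫ τ in Ico 0 1, ρ τ * D.v τ ≤ 0 := by
    have hw := D.integral_w_le ho hne hb hconv
    have e : ∫ τ in Ico 0 1, D.w τ = (∫ τ in Ico 0 1, ρ τ * D.v τ) +
        1 / R * ∫ τ in Ico 0 1, D.v τ := by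
      rw [← integral_const_mul, ← integral_add i0 (iv.const_mul _)]
      congr 1
      funext τ
      rw [hρv]
      ring
    rw [e, hV] at hw
    have : 1 / R * (2 * π * R) = 2 * π := by field_simp
    linarith
  refine ⟨fun τ => 1 - ε * ρ τ, contDiff_const.sub (contDiff_const.mul hρs),
    fun τ => by simp only [hρp τ], fun τ => ?_, ε * d, by positivity, ?_⟩
  · have h1 : ρ τ ≤ C := (le_abs_self _).trans (hC τ)
    have := mul_le_mul_of_nonneg_left h1 hεpos.le
    linarith
  · have e1 : (∫ τ in Ico 0 1, (1 - ε * ρ τ) ^ 2 * D.w τ) =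
        (∫ τ in Ico 0 1, ρ τ * D.v τ) + (-(2 * ε)) * d + ε ^ 2 * c₂ +
          1 / R * ∫ τ in Ico 0 1, (1 - ε * ρ τ) ^ 2 * D.v τ := by
      have j : IntegrableOn (fun τ => (1 - ε * ρ τ) ^ 2 * D.v τ) (Ico 0 1) :=
        integrableOn_Ico (by fun_prop)
      have i01 : IntegrableOn (fun τ => ρ τ * D.v τ + -(2 * ε) * (ρ τ ^ 2 * D.v τ)) (Ico 0 1) :=
        i0.add (i1.const_mul _)
      have i012 : IntegrableOn (fun τ => ρ τ * D.v τ + -(2 * ε) * (ρ τ ^ 2 * D.v τ) +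
          ε ^ 2 * (ρ τ ^ 3 * D.v τ)) (Ico 0 1) := i01.add (i2.const_mul _)
      rw [hd, hc₂, ← integral_const_mul, ← integral_const_mul, ← integral_const_mul,
        ← integral_add i0 (i1.const_mul _), ← integral_add i01 (i2.const_mul _),
        ← integral_add i012 (j.const_mul _)]
      congr 1
      funext τ
      rw [hρv]
      field_simp
      ring
    have e2 : ∫ τ in Ico 0 1, deriv (fun τ => 1 - ε * ρ τ) τ ^ 2 / D.v τ = ε ^ 2 * c₁ := by
      rw [hc₁, ← integral_const_mul]
      congr 1
      funext τ
      have : deriv (fun τ => 1 - ε * ρ τ) τ = -(ε * deriv ρ τ) :=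
        (((hρs.differentiable (by simp) τ).hasDerivAt.const_mul ε).const_sub 1).deriv
      rw [this]
      ring
    rw [e1, e2]
    have h2 : ε * (ε * (|c₂| + c * c₁ + 1)) ≤ ε * d := mul_le_mul_of_nonneg_left hε2 hεpos.le
    have h3 : ε ^ 2 * c₂ ≤ ε ^ 2 * |c₂| := mul_le_mul_of_nonneg_left (le_abs_self _) (sq_nonneg _)
    have h4 : 0 ≤ ε ^ 2 := sq_nonneg _
    rw [one_div_mul_eq_div]
    linarith

/-- Each good one-dimensional profile on the disk of the same perimeter produces a Rayleigh
quotient that is better by a uniform amount. -/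
lemma exists_gap (ho : IsOpen Ω) (hne : Ω.Nonempty) (hb : IsBounded Ω) (hconv : Convex ℝ Ω)
    (hnd : ¬ ∃ (x : E2) (r : ℝ), Ω = ball x r) {R : ℝ} (hR : 0 < R)
    (hV : ∫ τ in Ico 0 1, D.v τ = 2 * π * R) {α m₀ : ℝ} (hm₀ : 0 < m₀) :
    ∃ δ > 0, ∀ m ≥ m₀, ∀ h : ℝ → ℝ, ContDiff ℝ (⊤ : ℕ∞) h → HasCompactSupport h →
      R * ((∫ t in Ioi 0, (deriv h t ^ 2 + m * h t ^ 2)) + α * h 0 ^ 2) +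
        (∫ t in Ioi 0, (deriv h t ^ 2 + m * h t ^ 2) * t) < 0 →
      ∃ q ∈ robinSet α Ω, q ≤ -m - δ := by
  have hsm : 0 < √m₀ := sqrt_pos.2 hm₀
  obtain ⟨a, ha, hap, hapos, η, hη, hle⟩ :=
    D.exists_profile ho hne hb hconv hnd hR hV (1 / √m₀) (by positivity)
  set X := ∫ τ in Ico 0 1, a τ ^ 2 * D.v τ with hX
  set Y := ∫ τ in Ico 0 1, a τ ^ 2 * D.w τ with hY
  set Z := ∫ τ in Ico 0 1, deriv a τ ^ 2 / D.v τ with hZ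
  have hXpos : 0 < X := by
    have hca := ha.continuous
    have hcv := D.contDiff_v.continuous
    rw [hX, integral_Ico_eq_integral_Ioo, ← integral_Ioc_eq_integral_Ioo,
      ← intervalIntegral.integral_of_le zero_le_one]
    refine intervalIntegral.integral_pos one_pos (by fun_prop) (fun τ _ => ?_)
      ⟨0, by simp, ?_⟩
    · have := D.v_pos τ
      positivity
    · have := D.v_pos 0
      have := hapos 0
      positivity
  have hY0 : 0 ≤ Y := integral_nonneg fun τ => mul_nonneg (sq_nonneg _) (D.w_nonneg τ)
  have hZ0 : 0 ≤ Z := integral_nonneg fun τ => div_nonneg (sq_nonneg _) (D.v_pos τ).le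
  set M := (X + Y) * (1 / √m₀ + 1 / m₀) with hM
  have hMpos : 0 < M := by positivity
  refine ⟨η / M, by positivity, fun m hm h hh hs hneg => ?_⟩
  have hmpos : 0 < m := hm₀.trans_le hm
  obtain ⟨U, hU, hUs, hUa⟩ := D.exists_testFunction ho hne hconv ha hap hh hs
  have hform := D.robin_form_product_le ho hne hconv ha hh hs hU hUs hUa α m
  have hmass := D.integral_product_sq ho hne hconv ha hh hs hUa
  rw [← hX, ← hY] at hform hmass
  rw [← hZ] at hform
  have hch := hh.continuous
  have hch' := continuous_deriv_of_contDiff hh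
  have j2 : Integrable (fun t => (deriv h t ^ 2 + m * h t ^ 2) * t) :=
    hs.integrable_of_forall_eq_zero (by fun_prop) fun t h0 h1 => by simp [h0, h1]
  have j3 : Integrable (fun t => h t ^ 2 * t) :=
    hs.integrable_of_forall_eq_zero (by fun_prop) fun t h0 _ => by simp [h0]
  set K := ∫ t in Ioi 0, h t ^ 2
  set K₁ := ∫ t in Ioi 0, h t ^ 2 * t
  set B := ∫ t in Ioi 0, (deriv h t ^ 2 + m * h t ^ 2) * t with hB
  set A := ∫ t in Ioi 0, (deriv h t ^ 2 + m * h t ^ 2)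
  have hA0 : 0 ≤ A := integral_nonneg fun t => by positivity
  have hK0 : 0 ≤ K := integral_nonneg fun t => by positivity
  have hB0 : 0 ≤ B := setIntegral_nonneg measurableSet_Ioi fun t ht => by
    have : 0 < t := ht
    positivity
  have hKB : √m₀ * K ≤ B := by
    have h1 := mul_integral_sq_le_integral_Ioi (hh.of_le (by simp)) hs (√m)
    rw [sq_sqrt hmpos.le] at h1
    exact (mul_le_mul_of_nonneg_right (sqrt_le_sqrt hm) hK0).trans h1
  have hK₁0 : 0 ≤ K₁ := setIntegral_nonneg measurableSet_Ioi fun t ht => by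
    have : 0 < t := ht
    positivity
  have hK₁B : m₀ * K₁ ≤ B := by
    have h1 : m * K₁ ≤ B := by
      rw [hB, ← integral_const_mul]
      refine setIntegral_mono_on (j3.const_mul m).integrableOn j2.integrableOn measurableSet_Ioi
        fun t ht => ?_
      have : 0 < t := ht
      have : 0 ≤ deriv h t ^ 2 * t := by positivity
      linarith
    exact (mul_le_mul_of_nonneg_right hm hK₁0).trans h1
  have hx : ∃ x ∈ extDom Ω, U x ≠ 0 := by
    have h0 : h 0 ≠ 0 := by
      intro h0
      rw [h0] at hneg
      have := mul_nonneg hR.le hA0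
      linarith
    have h1 : ∀ᶠ t in nhdsWithin 0 (Ioi 0), h t ≠ 0 :=
      (hch.continuousAt.eventually_ne h0).filter_mono nhdsWithin_le_nhds
    obtain ⟨t, ht, hpos⟩ := (h1.and self_mem_nhdsWithin).exists
    refine ⟨D.pt 0 t, D.pt_mem_extDom hpos, ?_⟩
    rw [hUa 0 t (le_of_lt hpos)]
    exact mul_ne_zero (hapos 0).ne' ht
  have hS := integral_sq_pos_of_ne_zero hU hUs hx
  refine ⟨_, ⟨U, hU, hUs, hx, rfl⟩, ?_⟩
  rw [div_le_iff₀ hS]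
  have hKle : K ≤ B * (1 / √m₀) := by
    rw [mul_one_div, le_div_iff₀ hsm]; linarith
  have hK₁le : K₁ ≤ B * (1 / m₀) := by
    rw [mul_one_div, le_div_iff₀ hm₀]; linarith
  have hSB : (∫ x in extDom Ω, U x ^ 2) ≤ M * B := by
    rw [hmass, hM]
    have h1 := mul_le_mul_of_nonneg_left hKle hXpos.le
    have h2 := mul_le_mul_of_nonneg_left hK₁le hY0
    have h3 : 0 ≤ X * (B * (1 / m₀)) := by positivity
    have h4 : 0 ≤ Y * (B * (1 / √m₀)) := by positivity
    linarith
  have hSη : η / M * (∫ x in extDom Ω, U x ^ 2) ≤ η * B := by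
    have := mul_le_mul_of_nonneg_left hSB (div_pos hη hMpos).le
    rwa [← mul_assoc, div_mul_cancel₀ _ hMpos.ne'] at this
  have hA : X * (A + α * h 0 ^ 2) ≤ -(X / R * B) := by
    have h1 := mul_le_mul_of_nonneg_left hneg.le (div_pos hXpos hR).le
    have h2 : X / R * (R * (A + α * h 0 ^ 2)) = X * (A + α * h 0 ^ 2) := by field_simp
    rw [mul_add, h2] at h1
    linarith
  have h5 := mul_le_mul_of_nonneg_left hle hB0
  have h6 := mul_le_mul_of_nonneg_left hKle hZ0
  linarith

end Collar

lemma Collar.bddBelow_robinSet {Ω : Set E2} (D : Collar Ω) (ho : IsOpen Ω) (hne : Ω.Nonempty)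
    (hconv : Convex ℝ Ω) (α : ℝ) : BddBelow (robinSet α Ω) := by
  refine ⟨-(-α) ^ 2, ?_⟩
  rintro q ⟨u, hu, hs, hx, rfl⟩
  rw [le_div_iff₀ (integral_sq_pos_of_ne_zero hu hs hx)]
  have := D.robin_form_nonneg_of_slice ho hne hconv hu hs (α := α) (m := (-α) ^ 2) fun τ => by
    have h := mul_sq_le_integral_Ioi ((D.contDiff_slice hu τ).of_le (by simp))
      (D.hasCompactSupport_slice hs τ) (b := -α) (D.v_pos τ).le (D.w_nonneg τ)
    rw [D.pt_zero] at h
    linarith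
  linarith

/-- Outside a disk, every good test function has a good one-dimensional slice. -/
lemma exists_profile_of_mem_robinSet_ball {c : E2} {R : ℝ} (hR : 0 < R) {α m q : ℝ}
    (hq : q ∈ robinSet α (ball c R)) (hqm : q < -m) :
    ∃ h : ℝ → ℝ, ContDiff ℝ (⊤ : ℕ∞) h ∧ HasCompactSupport h ∧
      R * ((∫ t in Ioi 0, (deriv h t ^ 2 + m * h t ^ 2)) + α * h 0 ^ 2) +
        (∫ t in Ioi 0, (deriv h t ^ 2 + m * h t ^ 2) * t) < 0 := by
  obtain ⟨u, hu, hs, hx, rfl⟩ := hq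
  rw [div_lt_iff₀ (integral_sq_pos_of_ne_zero hu hs hx)] at hqm
  by_contra! hall
  refine absurd ((ballCollar c hR).robin_form_nonneg_of_slice isOpen_ball (nonempty_ball.2 hR)
    (convex_ball c R) hu hs (α := α) (m := m) fun τ => ?_) (by linarith)
  have hh := (ballCollar c hR).contDiff_slice hu τ
  have hhs := (ballCollar c hR).hasCompactSupport_slice hs τ
  rw [← (ballCollar c hR).pt_zero τ]
  set h := fun t => u ((ballCollar c hR).pt τ t)
  have h1 := hall h hh hhs
  have hch := hh.continuous
  have hch' := Collar.continuous_deriv_of_contDiff hh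
  have j1 : Integrable (fun t => deriv h t ^ 2 + m * h t ^ 2) :=
    hhs.integrable_of_forall_eq_zero (by fun_prop) fun t h0 h1 => by simp [h0, h1]
  have j2 : Integrable (fun t => (deriv h t ^ 2 + m * h t ^ 2) * t) :=
    hhs.integrable_of_forall_eq_zero (by fun_prop) fun t h0 h1 => by simp [h0, h1]
  have e : ∫ t in Ioi 0, (deriv h t ^ 2 + m * h t ^ 2) * (2 * π * R + t * (2 * π)) =
      2 * π * R * (∫ t in Ioi 0, (deriv h t ^ 2 + m * h t ^ 2)) +
        2 * π * ∫ t in Ioi 0, (deriv h t ^ 2 + m * h t ^ 2) * t := by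
    rw [← integral_const_mul, ← integral_const_mul,
      ← integral_add (j1.integrableOn.const_mul _) (j2.integrableOn.const_mul _)]
    congr 1
    funext t
    ring
  change 0 ≤ (∫ t in Ioi 0, (deriv h t ^ 2 + m * h t ^ 2) * (2 * π * R + t * (2 * π))) +
    α * (h 0 ^ 2 * (2 * π * R))
  rw [e]
  have h2 := mul_nonneg two_pi_pos.le h1
  linarith

/-- For small spectral parameter the one-dimensional form takes negative values. -/
lemma exists_profile_neg {R : ℝ} (hR : 0 < R) {α : ℝ} (hα : α < 0) :
    ∃ m > 0, ∃ h : ℝ → ℝ, ContDiff ℝ (⊤ : ℕ∞) h ∧ HasCompactSupport h ∧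
      R * ((∫ t in Ioi 0, (deriv h t ^ 2 + m * h t ^ 2)) + α * h 0 ^ 2) +
        (∫ t in Ioi 0, (deriv h t ^ 2 + m * h t ^ 2) * t) < 0 := by
  obtain ⟨h, hh, hs, hlt⟩ :=
    exists_integral_Ioi_deriv_sq_mul_lt R hR (mul_pos (neg_pos.2 hα) hR)
  have hch := hh.continuous
  have hch' := Collar.continuous_deriv_of_contDiff hh
  have i {F : ℝ → ℝ} (hF : Continuous F) (h0 : ∀ t, h t = 0 → deriv h t = 0 → F t = 0) :
      IntegrableOn F (Ioi 0) := (hs.integrable_of_forall_eq_zero hF h0).integrableOn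
  set K := ∫ t in Ioi 0, h t ^ 2 * (R + t) with hK
  have hK0 : 0 ≤ K := setIntegral_nonneg measurableSet_Ioi fun t ht => by
    have : 0 < t := ht
    positivity
  set g := -α * R * h 0 ^ 2 - ∫ t in Ioi 0, deriv h t ^ 2 * (R + t) with hg
  have hg0 : 0 < g := sub_pos.2 hlt
  have hm : 0 < g / (K + 1) := by positivity
  refine ⟨g / (K + 1), hm, h, hh, hs, ?_⟩
  set m := g / (K + 1) with hmdef
  have e : R * (∫ t in Ioi 0, (deriv h t ^ 2 + m * h t ^ 2)) +
      (∫ t in Ioi 0, (deriv h t ^ 2 + m * h t ^ 2) * t) =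
      (∫ t in Ioi 0, deriv h t ^ 2 * (R + t)) + m * K := by
    rw [hK, ← integral_const_mul, ← integral_const_mul, ← integral_add, ← integral_add]
    · congr 1
      funext t
      ring
    · exact i (by fun_prop) fun t h0 h1 => by simp [h1]
    · exact i (by fun_prop) fun t h0 h1 => by simp [h0]
    · exact i (by fun_prop) fun t h0 h1 => by simp [h0, h1]
    · exact i (by fun_prop) fun t h0 h1 => by simp [h0, h1]
  have h1 : m * K + m = g := by
    rw [hmdef]; field_simp
  linarith

/-- Uniqueness of the optimiser, isoperimetric case: a non-disk convex set gives a
strictly smaller exterior eigenvalue than the disk of the same perimeter. -/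
theorem reverse_spectral_isoperimetric_exterior_strict
    (α : ℝ) (hα : α < 0) (Ω : Set E2) (hne : Ω.Nonempty) (ho : IsOpen Ω)
    (hb : IsBounded Ω) (hconv : Convex ℝ Ω) (hsm : HasSmoothBoundary Ω)
    (hnd : ¬ ∃ (x : E2) (r : ℝ), Ω = ball x r)
    (c : E2) (R₁ : ℝ) (hR₁ : 0 < R₁)
    (hper : μH[1] (frontier (ball c R₁)) = μH[1] (frontier Ω)) :
    robinEig α Ω < robinEig α (ball c R₁) := by
  obtain ⟨D⟩ := hsm.nonempty_collar ho hne hconv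
  have hV : ∫ τ in Ico 0 1, D.v τ = 2 * π * R₁ := by
    have hball : ∫ τ in Ico (0 : ℝ) 1, (ballCollar c hR₁).v τ = 2 * π * R₁ := by
      simp [ballCollar]
    rw [(ballCollar c hR₁).hausdorffMeasure_frontier, D.hausdorffMeasure_frontier,
      ENNReal.ofReal_eq_ofReal_iff (by rw [hball]; positivity)
        (integral_nonneg fun τ => (D.v_pos τ).le), hball] at hper
    exact hper.symm
  have hbdd := D.bddBelow_robinSet ho hne hconv α
  rcases le_or_gt 0 (robinEig α (ball c R₁)) with hlam | hlam
  · obtain ⟨m, hm, h, hh, hs, hneg⟩ := exists_profile_neg hR₁ hα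
    obtain ⟨δ, hδ, H⟩ := D.exists_gap ho hne hb hconv hnd hR₁ hV (α := α) hm
    obtain ⟨q, hq, hqm⟩ := H m le_rfl h hh hs hneg
    have : robinEig α Ω ≤ q := csInf_le hbdd hq
    linarith
  · set l := robinEig α (ball c R₁) with hl
    obtain ⟨δ, hδ, H⟩ := D.exists_gap ho hne hb hconv hnd hR₁ hV (α := α) (m₀ := -l / 2)
      (by linarith)
    have hNe : (robinSet α (ball c R₁)).Nonempty := by
      by_contra hempty
      rw [not_nonempty_iff_eq_empty] at hempty
      have : l = sInf (robinSet α (ball c R₁)) := rfl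
      rw [hempty, Real.sInf_empty] at this
      exact hlam.ne this
    set p := l + min (δ / 2) (-l / 2) with hp
    have hmin : 0 < min (δ / 2) (-l / 2) := lt_min (by linarith) (by linarith)
    obtain ⟨q, hq, hqp⟩ := exists_lt_of_csInf_lt hNe (b := p)
      (show l < p by linarith)
    obtain ⟨h, hh, hs, hneg⟩ := exists_profile_of_mem_robinSet_ball hR₁ (m := -p) hq (by linarith)
    have h1 := min_le_left (δ / 2) (-l / 2)
    have h2 := min_le_right (δ / 2) (-l / 2)
    obtain ⟨q', hq', hqm⟩ := H (-p) (by linarith) h hh hs hneg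
    have : robinEig α Ω ≤ q' := csInf_le hbdd hq'
    linarith

end
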